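/- arXiv:1810.05030 — 6 statements merged into one kernel-verified Lean document; each statement's English description precedes it below -/
import Mathlib

section
/- Let n be odd and let Q : ℝ^n → ℝ^n be a homogeneous polynomial map of degree m ≥ 1. Then there exists c ≠ 0 such that Q(c) ∈ ℝ·c, i.e., Q admits a real eigenvector. -/
open MeasureTheory Module
open scoped Pointwise

lemma poly_contra (P : Polynomial ℝ) (a : ℝ) (ha : a ≠ 0) (n : ℕ) (hn : Odd n)
    (h : P ^ 2 = Polynomial.C a * (1 + Polynomial.X ^ 2) ^ n) : False := by
  have h2 := congrArg (Polynomial.map Complex.ofRealHom) h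
  have hf : (1 + Polynomial.X ^ 2 : Polynomial ℂ)
      = (Polynomial.X - Polynomial.C Complex.I) * (Polynomial.X - Polynomial.C (-Complex.I)) := by
    have : (Polynomial.C Complex.I) * (Polynomial.C Complex.I) = (-1 : Polynomial ℂ) := by
      rw [← Polynomial.C_mul, Complex.I_mul_I]; simp
    rw [Polynomial.C_neg]
    linear_combination this
  simp only [Polynomial.map_pow, Polynomial.map_mul, Polynomial.map_C, Polynomial.map_add,
    Polynomial.map_one, Polynomial.map_X] at h2
  rw [hf] at h2
  have h3 := congrArg (fun p => Multiset.count Complex.I p.roots) h2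
  have hI : Complex.I ≠ -Complex.I := by
    intro h; have := congrArg Complex.im h; norm_num at this
  have ha' : Complex.ofRealHom a ≠ 0 := by simpa using ha
  beta_reduce at h3
  rw [Polynomial.roots_C_mul _ ha', Polynomial.roots_pow, Polynomial.roots_pow,
    Polynomial.roots_mul (mul_ne_zero (Polynomial.X_sub_C_ne_zero _) (Polynomial.X_sub_C_ne_zero _)),
    Polynomial.roots_X_sub_C, Polynomial.roots_X_sub_C, Multiset.count_nsmul, Multiset.count_nsmul,
    Multiset.count_add, Multiset.count_singleton_self, Multiset.count_singleton, if_neg hI] at h3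
  obtain ⟨k, rfl⟩ := hn
  omega

section
variable {E : Type*} [NormedAddCommGroup E] [InnerProductSpace ℝ E] [FiniteDimensional ℝ E]

lemma det_interp (A : E →L[ℝ] E) (t : ℝ) :
    (1 + t • A).det = ∑ i ∈ Finset.range (finrank ℝ E + 1), (1 + (i : ℝ) • A).det *
      Polynomial.eval t (Lagrange.basis (Finset.range (finrank ℝ E + 1)) (fun i : ℕ => (i : ℝ)) i) := by
  let b := finBasis ℝ E
  let M := LinearMap.toMatrix b b (A : E →ₗ[ℝ] E)
  let f : Polynomial ℝ := ((Polynomial.X : Polynomial ℝ) • M.map Polynomial.C + (1 : Matrix (Fin (finrank ℝ E)) (Fin (finrank ℝ E)) ℝ).map Polynomial.C).det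
  have hf : ∀ s : ℝ, Polynomial.eval s f = (1 + s • A).det := by
    intro s
    have e1 : (1 + s • A).det = LinearMap.det (1 + s • (A : E →ₗ[ℝ] E)) := rfl
    rw [e1, ← LinearMap.det_toMatrix b]
    simp only [f]
    rw [← Polynomial.coe_evalRingHom, RingHom.map_det]
    congr 1
    ext i j
    simp [M, LinearMap.toMatrix_one, add_comm, Matrix.map_apply, Matrix.one_apply]
    split_ifs <;> simp [mul_comm]
  have hd : f.degree < ((Finset.range (finrank ℝ E + 1)).card : WithBot ℕ) := by
    have := Polynomial.natDegree_det_X_add_C_le M 1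
    rw [Fintype.card_fin] at this
    refine lt_of_le_of_lt Polynomial.degree_le_natDegree ?_
    rw [Finset.card_range]
    exact_mod_cast Nat.lt_succ_of_le this
  have := Lagrange.eq_interpolate (v := fun i : ℕ => (i : ℝ)) (by intro i _ j _ h; exact Nat.cast_injective h) hd
  rw [← hf, this, Lagrange.interpolate_apply, Polynomial.eval_finsetSum]
  refine Finset.sum_congr rfl fun i _ => ?_
  rw [Polynomial.eval_mul, Polynomial.eval_C, hf]

lemma det_pos (A : E →L[ℝ] E) (t C : ℝ) (ht : 0 ≤ t) (hA : ‖A‖ ≤ C) (h : t * C < 1) :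
    0 < (1 + t • A).det := by
  have hne : ∀ s ∈ Set.Icc 0 t, (1 + s • A).det ≠ 0 := by
    intro s hs h0
    have e1 : (1 + s • A).det = LinearMap.det (1 + s • (A : E →ₗ[ℝ] E)) := rfl
    rw [e1] at h0
    obtain ⟨x, hx, hx0⟩ := Submodule.exists_mem_ne_zero_of_ne_bot (LinearMap.bot_lt_ker_of_det_eq_zero h0).ne'
    have hx' : x + s • A x = 0 := by simpa using hx
    have : ‖x‖ = s * ‖A x‖ := by
      conv_lhs => rw [eq_neg_of_add_eq_zero_left hx', norm_neg, norm_smul, Real.norm_of_nonneg hs.1]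
    have h1 := A.le_of_opNorm_le hA x
    have h2 : 0 < ‖x‖ := norm_pos_iff.2 hx0
    have h3 : s * ‖A x‖ ≤ t * (C * ‖x‖) := mul_le_mul hs.2 h1 (norm_nonneg _) ht
    nlinarith
  by_contra hneg
  push Not at hneg
  have hc : ContinuousOn (fun s : ℝ => (1 + s • A).det) (Set.Icc 0 t) := by
    apply Continuous.continuousOn
    exact ContinuousLinearMap.continuous_det.comp (by fun_prop)
  have := intermediate_value_Icc' ht hc
  obtain ⟨s, hs, h0⟩ := this ⟨hneg, by
    have : (1 : E →L[ℝ] E).det = 1 := LinearMap.det_id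
    simp [this]⟩
  exact hne s hs h0

lemma core [MeasurableSpace E] [BorelSpace E] (hodd : Odd (finrank ℝ E)) (w : E → E) (C : NNReal)
    (hL : LipschitzWith C w) (hs : ContDiffOn ℝ 1 w {0}ᶜ) (hnorm : ∀ x, ‖w x‖ = ‖x‖)
    (hin : ∀ x, inner ℝ x (w x) = 0) : False := by
  let μ : Measure E := volume
  let K : Set E := Metric.closedBall 0 2 \ Metric.ball 0 1
  have hKc : IsCompact K := (isCompact_closedBall _ _).diff Metric.isOpen_ball
  have hKmem : ∀ x, x ∈ K ↔ ‖x‖ ≤ 2 ∧ 1 ≤ ‖x‖ := by intro x; simp [K]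
  have hK0 : K ⊆ {0}ᶜ := by
    intro x hx h0
    rw [Set.mem_singleton_iff] at h0
    have := ((hKmem x).1 hx).2
    simp [h0] at this; linarith
  have : Nontrivial E := finrank_pos_iff.1 hodd.pos
  have hKpos : 0 < μ.real K := by
    rw [Measure.real, ENNReal.toReal_pos_iff]
    refine ⟨?_, hKc.measure_lt_top⟩
    obtain ⟨x, hx⟩ := NormedSpace.exists_lt_norm ℝ E 0
    have ho : IsOpen (Metric.ball (0:E) 2 ∩ (Metric.closedBall 0 1)ᶜ) :=
      Metric.isOpen_ball.inter Metric.isClosed_closedBall.isOpen_compl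
    refine lt_of_lt_of_le (ho.measure_pos μ ⟨((3/2) * ‖x‖⁻¹ : ℝ) • x, ?_⟩) (measure_mono ?_)
    · have : ‖((3/2) * ‖x‖⁻¹ : ℝ) • x‖ = 3/2 := by
        rw [norm_smul, norm_mul, norm_inv, norm_norm, mul_assoc, inv_mul_cancel₀ hx.ne']; norm_num
      simp only [Set.mem_inter_iff, Set.mem_compl_iff, mem_ball_zero_iff, mem_closedBall_zero_iff, this]
      norm_num
    · intro y hy
      simp only [Set.mem_inter_iff, Set.mem_compl_iff, mem_ball_zero_iff, mem_closedBall_zero_iff, not_le] at hy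
      exact (hKmem y).2 ⟨hy.1.le, hy.2.le⟩
  let D := finrank ℝ E
  let P : Polynomial ℝ := ∑ i ∈ Finset.range (D + 1),
    Polynomial.C (∫ x in K, (1 + (i : ℝ) • fderiv ℝ w x).det ∂μ) *
      Lagrange.basis (Finset.range (D + 1)) (fun i : ℕ => (i : ℝ)) i
  have hcont : ContinuousOn (fderiv ℝ w) K :=
    (hs.continuousOn_fderiv_of_isOpen isOpen_compl_singleton le_rfl).mono hK0
  have hP : ∀ t, P.eval t = ∫ x in K, (1 + t • fderiv ℝ w x).det ∂μ := by
    intro t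
    simp_rw [det_interp _ t]
    rw [integral_finsetSum]
    · simp only [P, Polynomial.eval_finsetSum, Polynomial.eval_mul, Polynomial.eval_C, integral_mul_const]
      rfl
    · intro i _
      apply Integrable.mul_const
      apply ContinuousOn.integrableOn_compact hKc
      exact ContinuousLinearMap.continuous_det.comp_continuousOn
        (continuousOn_const.add (hcont.const_smul (i : ℝ)) : ContinuousOn (fun x => 1 + (i : ℝ) • fderiv ℝ w x) K)
  have key : ∀ t : ℝ, 0 < t → t * C < 1 → P.eval t = |Real.sqrt (1 + t ^ 2) ^ D| * μ.real K := by
    intro t ht htC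
    set f : E → E := fun x => x + t • w x with hf
    have hfn : ∀ x, ‖f x‖ = Real.sqrt (1 + t ^ 2) * ‖x‖ := by
      intro x
      have : ‖f x‖ ^ 2 = (1 + t ^ 2) * ‖x‖ ^ 2 := by
        rw [hf]; simp only []
        rw [norm_add_sq_real, inner_smul_right, hin, norm_smul, hnorm, mul_pow, Real.norm_eq_abs, sq_abs]
        ring
      rw [← Real.sqrt_sq (norm_nonneg (f x)), this, Real.sqrt_mul (by positivity),
        Real.sqrt_sq (norm_nonneg x)]
    have hlip : ∀ x y, ‖w x - w y‖ ≤ C * ‖x - y‖ := fun x y => hL.norm_sub_le x y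
    have hinj : Function.Injective f := by
      intro x y hxy
      have h1 : x - y = t • (w y - w x) := by
        simp only [hf] at hxy
        rw [smul_sub, sub_eq_sub_iff_add_eq_add, hxy, add_comm]
      have h2 : ‖x - y‖ ≤ t * (C * ‖x - y‖) := by
        conv_lhs => rw [h1]
        rw [norm_smul, Real.norm_of_nonneg ht.le, norm_sub_rev]
        exact mul_le_mul_of_nonneg_left (hlip x y) ht.le
      by_contra hne
      have : 0 < ‖x - y‖ := norm_pos_iff.2 (sub_ne_zero.2 hne)
      nlinarith
    have hsurj : Function.Surjective f := by
      intro y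
      have hcw : ContractingWith (t.toNNReal * C) (fun x => y - t • w x) := by
        refine ⟨?_, ?_⟩
        · rw [← NNReal.coe_lt_coe]; simpa [ht.le] using htC
        · refine LipschitzWith.of_dist_le_mul fun a b => ?_
          rw [dist_eq_norm, dist_eq_norm, sub_sub_sub_cancel_left, ← smul_sub, norm_smul,
            Real.norm_of_nonneg ht.le, norm_sub_rev]
          push_cast
          rw [Real.coe_toNNReal _ ht.le, mul_assoc]
          exact mul_le_mul_of_nonneg_left (hlip a b) ht.le
      refine ⟨hcw.fixedPoint, ?_⟩
      have := hcw.fixedPoint_isFixedPt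
      simp only [Function.IsFixedPt] at this
      simp only [hf]
      nth_rewrite 1 [← this]
      simp
    have hr : 0 < Real.sqrt (1 + t ^ 2) := Real.sqrt_pos.2 (by positivity)
    have himg : f '' K = Real.sqrt (1 + t ^ 2) • K := by
      ext y
      rw [Set.mem_smul_set_iff_inv_smul_mem₀ hr.ne', hKmem, norm_smul, norm_inv, Real.norm_of_nonneg hr.le]
      constructor
      · rintro ⟨x, hx, rfl⟩
        rw [hfn, inv_mul_cancel_left₀ hr.ne']
        exact (hKmem x).1 hx
      · intro h
        obtain ⟨x, rfl⟩ := hsurj y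
        rw [hfn, inv_mul_cancel_left₀ hr.ne'] at h
        exact ⟨x, (hKmem x).2 h, rfl⟩
    have hder : ∀ x ∈ K, HasFDerivWithinAt f (1 + t • fderiv ℝ w x) K x := by
      intro x hx
      have hd : DifferentiableAt ℝ w x :=
        (hs.contDiffAt (isOpen_compl_singleton.mem_nhds (hK0 hx))).differentiableAt one_ne_zero
      exact ((hasFDerivAt_id x).add (hd.hasFDerivAt.const_smul t)).hasFDerivWithinAt
    have hch := integral_image_eq_integral_abs_det_fderiv_smul μ hKc.measurableSet hder hinj.injOn
      (fun _ => (1 : ℝ))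
    rw [hP]
    have h1 : ∫ x in K, (1 + t • fderiv ℝ w x).det ∂μ
        = ∫ x in K, |(1 + t • fderiv ℝ w x).det| • (1:ℝ) ∂μ := by
      congr 1; ext x
      rw [abs_of_pos (det_pos _ t C ht.le (norm_fderiv_le_of_lipschitz ℝ hL) htC)]; simp
    rw [h1, ← hch, himg]
    simp only [integral_const, smul_eq_mul, mul_one, measureReal_restrict_apply_univ]
    rw [Measure.real, Measure.addHaar_smul, ENNReal.toReal_mul, ENNReal.toReal_ofReal (abs_nonneg _)]
    rfl
  apply poly_contra P (μ.real K ^ 2) (by positivity) D hodd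
  apply Polynomial.eq_of_infinite_eval_eq
  have hpos : (0:ℝ) < 1 / (C + 1) := by positivity
  refine (Set.Ioo_infinite hpos).mono fun t ht => ?_
  have htC : t * C < 1 := by
    have := (lt_div_iff₀ (by positivity)).1 ht.2
    nlinarith [ht.1]
  simp only [Set.mem_ofPred_eq, Polynomial.eval_pow, Polynomial.eval_mul, Polynomial.eval_C,
    Polynomial.eval_add, Polynomial.eval_one, Polynomial.eval_X]
  rw [key t ht.1 htC, mul_pow, sq_abs, ← pow_mul, mul_comm D 2, pow_mul,
    Real.sq_sqrt (by positivity)]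
  ring

lemma hairy [MeasurableSpace E] [BorelSpace E] (hodd : Odd (finrank ℝ E)) (v : E → E)
    (hs : ContDiff ℝ 1 v) (hne : ∀ x, x ≠ 0 → v x ≠ 0)
    (hin : ∀ x, inner ℝ x (v x) = 0) : False := by
  let u : E → E := fun x => ‖v (‖x‖⁻¹ • x)‖⁻¹ • v (‖x‖⁻¹ • x)
  let w : E → E := fun x => ‖x‖ • u x
  have hx0 : ∀ x : E, x ≠ 0 → ‖x‖⁻¹ • x ≠ 0 := fun x hx =>
    smul_ne_zero (inv_ne_zero (norm_ne_zero_iff.2 hx)) hx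
  have hu1 : ∀ x, x ≠ 0 → ‖u x‖ = 1 := by
    intro x hx
    simp only [u]
    rw [norm_smul, norm_inv, norm_norm, inv_mul_cancel₀ (norm_ne_zero_iff.2 (hne _ (hx0 x hx)))]
  have huD : ∀ x, x ≠ 0 → ContDiffAt ℝ 1 u x := by
    intro x hx
    have hn : ContDiffAt ℝ 1 (fun x : E => ‖x‖⁻¹ • x) x :=
      ((contDiffAt_norm ℝ hx).inv (norm_ne_zero_iff.2 hx)).smul contDiffAt_id
    have hv : ContDiffAt ℝ 1 (fun x : E => v (‖x‖⁻¹ • x)) x := hs.contDiffAt.comp x hn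
    exact ((hv.norm ℝ (hne _ (hx0 x hx))).inv (norm_ne_zero_iff.2 (hne _ (hx0 x hx)))).smul hv
  have huh : ∀ x : E, x ≠ 0 → u (‖x‖⁻¹ • x) = u x := by
    intro x hx
    have : ‖‖x‖⁻¹ • x‖ = 1 := by
      rw [norm_smul, norm_inv, norm_norm, inv_mul_cancel₀ (norm_ne_zero_iff.2 hx)]
    simp only [u, this, inv_one, one_smul]
  obtain ⟨C, hC⟩ : ∃ C, LipschitzOnWith C u (Metric.sphere 0 1) := by
    apply LocallyLipschitzOn.exists_lipschitzOnWith_of_compact (isCompact_sphere _ _)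
    intro x hx
    have hx' : x ≠ 0 := by rintro rfl; simp at hx
    obtain ⟨K, t, ht, h⟩ := (huD x hx').exists_lipschitzOnWith
    exact ⟨K, t, mem_nhdsWithin_of_mem_nhds ht, h⟩
  have hmain : ∀ x y : E, x ≠ 0 → y ≠ 0 → ‖w x - w y‖ ≤ (2 * C + 1) * ‖x - y‖ := by
    intro x y hx hy
    have hxn := norm_pos_iff.2 hx
    have hyn := norm_pos_iff.2 hy
    have h1 : w x - w y = ‖x‖ • (u x - u y) + (‖x‖ - ‖y‖) • u y := by
      simp only [w]; module
    have hsph : ∀ x : E, x ≠ 0 → ‖x‖⁻¹ • x ∈ Metric.sphere (0:E) 1 := by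
      intro x hx
      rw [mem_sphere_zero_iff_norm, norm_smul, norm_inv, norm_norm,
        inv_mul_cancel₀ (norm_ne_zero_iff.2 hx)]
    have h2 : ‖u x - u y‖ ≤ C * ‖‖x‖⁻¹ • x - ‖y‖⁻¹ • y‖ := by
      rw [← huh x hx, ← huh y hy]
      exact hC.norm_sub_le (hsph x hx) (hsph y hy)
    have h5 := abs_norm_sub_norm_le x y
    have h3 : ‖x‖ * ‖‖x‖⁻¹ • x - ‖y‖⁻¹ • y‖ ≤ 2 * ‖x - y‖ := by
      have e : ‖x‖ • (‖x‖⁻¹ • x - ‖y‖⁻¹ • y) = (x - y) + (‖y‖ - ‖x‖) • (‖y‖⁻¹ • y) := by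
        rw [smul_sub, smul_inv_smul₀ hxn.ne', sub_smul, smul_inv_smul₀ hyn.ne']
        abel
      have : ‖x‖ * ‖‖x‖⁻¹ • x - ‖y‖⁻¹ • y‖ = ‖‖x‖ • (‖x‖⁻¹ • x - ‖y‖⁻¹ • y)‖ := by
        rw [norm_smul, norm_norm]
      rw [this, e]
      refine (norm_add_le _ _).trans ?_
      rw [norm_smul, mem_sphere_zero_iff_norm.1 (hsph y hy), Real.norm_eq_abs, abs_sub_comm]
      linarith
    rw [h1]
    refine (norm_add_le _ _).trans ?_
    rw [norm_smul, norm_smul, norm_norm, hu1 y hy, Real.norm_eq_abs]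
    have h4 : ‖x‖ * ‖u x - u y‖ ≤ C * (‖x‖ * ‖‖x‖⁻¹ • x - ‖y‖⁻¹ • y‖) := by
      calc _ ≤ ‖x‖ * (C * ‖‖x‖⁻¹ • x - ‖y‖⁻¹ • y‖) := mul_le_mul_of_nonneg_left h2 hxn.le
        _ = _ := by ring
    have h6 := mul_le_mul_of_nonneg_left h3 C.coe_nonneg
    nlinarith
  have hwn : ∀ x, ‖w x‖ = ‖x‖ := by
    intro x
    by_cases hx : x = 0
    · simp [w, hx]
    · simp only [w]; rw [norm_smul, hu1 x hx, norm_norm, mul_one]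
  refine core hodd w (2 * C + 1) ?_ ?_ hwn ?_
  · refine LipschitzWith.of_dist_le_mul fun x y => ?_
    rw [dist_eq_norm, dist_eq_norm]
    push_cast
    have hC0 := C.coe_nonneg
    by_cases hx : x = 0
    · have : w x = 0 := by simp [w, hx]
      rw [this, hx, zero_sub, zero_sub, norm_neg, norm_neg, hwn]
      nlinarith [norm_nonneg y]
    by_cases hy : y = 0
    · have : w y = 0 := by simp [w, hy]
      rw [this, hy, sub_zero, sub_zero, hwn]
      nlinarith [norm_nonneg x]
    exact hmain x y hx hy
  · intro x hx
    exact ((contDiffAt_norm ℝ hx).smul (huD x hx)).contDiffWithinAt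
  · intro x
    by_cases hx : x = 0
    · simp [hx]
    have := hin (‖x‖⁻¹ • x)
    rw [inner_smul_left] at this
    simp only [w, u, inner_smul_right]
    have h' : inner ℝ x (v (‖x‖⁻¹ • x)) = 0 := by
      rcases mul_eq_zero.1 this with h | h
      · simp [hx] at h
      · exact h
    rw [h']; ring
end

/-- For odd `n`, every homogeneous polynomial map `Q : ℝⁿ → ℝⁿ` of degree `m ≥ 1` admits a
real eigenvector: some `c ≠ 0` with `Q c ∈ ℝ·c`. -/
theorem stmt_6 {n m : ℕ} (hn : Odd n) (hm : 1 ≤ m)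
    (Q : (Fin n → ℝ) → (Fin n → ℝ))
    (hQ : ∀ i : Fin n, ∃ p : MvPolynomial (Fin n) ℝ, p.IsHomogeneous m ∧
      ∀ x : Fin n → ℝ, Q x i = MvPolynomial.eval x p) :
    ∃ c : Fin n → ℝ, c ≠ 0 ∧ ∃ l : ℝ, Q c = l • c := by
  by_contra hcon
  push Not at hcon
  let R : EuclideanSpace ℝ (Fin n) → EuclideanSpace ℝ (Fin n) :=
    fun x => WithLp.toLp 2 (Q (WithLp.ofLp x))
  have hR : ContDiff ℝ 1 R := by
    rw [contDiff_euclidean]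
    intro i
    obtain ⟨p, -, hp⟩ := hQ i
    have : (fun x => R x i) = fun x : EuclideanSpace ℝ (Fin n) => MvPolynomial.eval (WithLp.ofLp x) p := by
      ext x; exact hp _
    rw [this]
    simp only [MvPolynomial.eval_eq]
    fun_prop
  refine hairy (E := EuclideanSpace ℝ (Fin n)) (by simpa using hn)
    (fun x => (inner ℝ x x : ℝ) • R x - (inner ℝ x (R x) : ℝ) • x) ?_ ?_ ?_
  · exact ((contDiff_id.inner ℝ contDiff_id).smul hR).sub ((contDiff_id.inner ℝ hR).smul contDiff_id)
  · intro x hx h0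
    have hxx : (inner ℝ x x : ℝ) ≠ 0 := inner_self_ne_zero.2 hx
    refine hcon (WithLp.ofLp x) (by simpa using hx) ((inner ℝ x x)⁻¹ * inner ℝ x (R x)) ?_
    have h1 : R x = ((inner ℝ x x)⁻¹ * inner ℝ x (R x) : ℝ) • x := by
      rw [mul_smul, ← sub_eq_zero.1 h0, inv_smul_smul₀ hxx]
    exact congrArg WithLp.ofLp h1
  · intro x
    rw [inner_sub_right, inner_smul_right, inner_smul_right]
    ring
end

section
/- Let Q : ℝ^n → ℝ^n be a homogeneous polynomial map of degree m such that the derivative DQ(x) is a symmetric linear map for every x ∈ ℝ^n. Then there exist v ∈ ℝ^n with v ≠ 0 and λ ∈ ℝ such that Q(v) = λ v. -/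
/-- A homogeneous polynomial map `Q : ℝⁿ → ℝⁿ` of degree `m` whose derivative `DQ(x)` is
symmetric for every `x` (i.e. `Q` is a gradient field) admits a real eigenvector. -/
theorem stmt_7 {n m : ℕ} (hn : 0 < n)
    (Q : (Fin n → ℝ) → (Fin n → ℝ))
    (hQ : ∀ i : Fin n, ∃ p : MvPolynomial (Fin n) ℝ, p.IsHomogeneous m ∧
      ∀ x : Fin n → ℝ, Q x i = MvPolynomial.eval x p)
    (hsym : ∀ x y z : Fin n → ℝ,
      ∑ i, fderiv ℝ Q x y i * z i = ∑ i, fderiv ℝ Q x z i * y i) :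
    ∃ (v : Fin n → ℝ) (l : ℝ), v ≠ 0 ∧ Q v = l • v := by
  choose p hp hpe using hQ
  have hQs : ContDiff ℝ 1 Q := by
    rw [contDiff_pi]
    intro i
    have h : (fun x => Q x i) = fun x => MvPolynomial.eval x (p i) := by
      ext x; exact hpe i x
    rw [h]
    induction p i using MvPolynomial.induction_on with
    | C a => simpa using contDiff_const
    | add p q h1 h2 => simpa using h1.add h2
    | mul_X p j h1 => simpa using h1.mul (contDiff_apply ℝ ℝ j)
  have hhom : ∀ (t : ℝ) (x : Fin n → ℝ), Q (t • x) = t ^ m • Q x := by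
    intro t x
    ext i
    rw [Pi.smul_apply, hpe, hpe, smul_eq_mul]
    rw [MvPolynomial.eval_eq, MvPolynomial.eval_eq, Finset.mul_sum]
    refine Finset.sum_congr rfl fun d hd => ?_
    have hdeg : ∑ j ∈ d.support, d j = m := by
      have := hp i (MvPolynomial.mem_support_iff.mp hd)
      rw [Finsupp.weight_apply] at this
      simpa [Finsupp.sum] using this
    simp only [Pi.smul_apply, smul_eq_mul, mul_pow, Finset.prod_mul_distrib,
      Finset.prod_pow_eq_pow_sum, hdeg]
    ring
  have hQd : ∀ x, HasStrictFDerivAt Q (fderiv ℝ Q x) x := fun x =>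
    hQs.contDiffAt.hasStrictFDerivAt (by norm_num)
  have heuler : ∀ x, fderiv ℝ Q x x = (m : ℝ) • Q x := by
    intro x
    have h1 : HasDerivAt (fun t : ℝ => t • x) x 1 := by
      simpa using (hasDerivAt_id (1 : ℝ)).smul_const x
    have h2 : HasDerivAt (fun t : ℝ => Q (t • x)) (fderiv ℝ Q x x) 1 := by
      have h3 : HasFDerivAt Q (fderiv ℝ Q x) ((1 : ℝ) • x) := by
        rw [one_smul]; exact (hQd x).hasFDerivAt
      exact h3.comp_hasDerivAt (1 : ℝ) h1
    have h4 : HasDerivAt (fun t : ℝ => Q (t • x)) ((m : ℝ) • Q x) 1 := by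
      simp only [hhom]
      simpa using (hasDerivAt_pow m (1 : ℝ)).smul_const (Q x)
    exact h2.unique h4
  let pr : Fin n → ((Fin n → ℝ) →L[ℝ] ℝ) := fun i => ContinuousLinearMap.proj i
  have hprd : ∀ i x, HasStrictFDerivAt (fun x : Fin n → ℝ => x i) (pr i) x := fun i x =>
    (pr i).hasStrictFDerivAt
  have hf : ∀ x, HasStrictFDerivAt (fun x => ∑ i, Q x i * x i)
      (∑ i, (Q x i • pr i + x i • (pr i).comp (fderiv ℝ Q x))) x := fun x =>
    HasStrictFDerivAt.fun_sum fun i _ =>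
      ((pr i).hasStrictFDerivAt.comp x (hQd x)).mul (hprd i x)
  have hg : ∀ x, HasStrictFDerivAt (fun x : Fin n → ℝ => ∑ i, x i * x i)
      (∑ i, (x i • pr i + x i • pr i)) x := fun x =>
    HasStrictFDerivAt.fun_sum fun i _ => (hprd i x).mul (hprd i x)
  have hgc : Continuous (fun x : Fin n → ℝ => ∑ i, x i * x i) := by fun_prop
  have hQc := hQs.continuous
  have hcomp : IsCompact {x : Fin n → ℝ | ∑ i, x i * x i = 1} := by
    refine Metric.isCompact_of_isClosed_isBounded (isClosed_eq hgc continuous_const) ?_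
    refine (Metric.isBounded_closedBall (x := (0 : Fin n → ℝ)) (r := 1)).subset ?_
    intro x hx
    simp only [Set.mem_setOf_eq] at hx
    rw [mem_closedBall_zero_iff, pi_norm_le_iff_of_nonneg zero_le_one]
    intro i
    have := Finset.single_le_sum (f := fun i => x i * x i)
      (fun i _ => mul_self_nonneg _) (Finset.mem_univ i)
    rw [Real.norm_eq_abs]
    exact abs_le_one_iff_mul_self_le_one.mpr (by simpa [hx] using this)
  obtain ⟨v, hv, hmax⟩ := hcomp.exists_isMaxOn
    (f := fun x => ∑ i, Q x i * x i)
    ⟨Pi.single ⟨0, hn⟩ 1, by simp [Pi.single_apply]⟩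
    (by fun_prop)
  simp only [Set.mem_setOf_eq] at hv
  have hv0 : v ≠ 0 := by
    rintro rfl
    simp at hv
  have hext : IsLocalExtrOn (fun x => ∑ i, Q x i * x i)
      {x : Fin n → ℝ | (fun x : Fin n → ℝ => ∑ i, x i * x i) x
        = (fun x : Fin n → ℝ => ∑ i, x i * x i) v} v := by
    simp only [hv]
    exact Or.inr hmax.localize
  obtain ⟨a, b, hab, h⟩ := hext.exists_multipliers_of_hasStrictFDerivAt_1d (hg v) (hf v)
  have key : ∀ y : Fin n → ℝ,
      ∑ i, (a * (2 * v i) + b * ((m + 1) * Q v i)) * y i = 0 := by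
    intro y
    have h1 := DFunLike.congr_fun h y
    have h2 := hsym v y v
    rw [heuler] at h2
    simp [pr, Finset.sum_add_distrib] at h1 h2
    have h3 : ∑ i, v i * (fderiv ℝ Q v) y i = ∑ i, m * Q v i * y i := by
      rw [← h2]; exact Finset.sum_congr rfl fun i _ => mul_comm _ _
    rw [h3] at h1
    rw [← h1]
    simp only [mul_add, Finset.mul_sum, ← Finset.sum_add_distrib]
    exact Finset.sum_congr rfl fun i _ => by ring
  have key2 : ∀ j, a * (2 * v j) + b * ((m + 1) * Q v j) = 0 := by
    intro j
    simpa [Pi.single_apply] using key (Pi.single j 1)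
  have hm : (m : ℝ) + 1 ≠ 0 := by positivity
  have hb : b ≠ 0 := by
    rintro rfl
    obtain ⟨j, hj⟩ := Function.ne_iff.mp hv0
    have := key2 j
    simp at this hj
    exact hab (by simp [this.resolve_right hj])
  refine ⟨v, -(2 * a) / (b * (m + 1)), hv0, ?_⟩
  ext j
  have := key2 j
  simp only [Pi.smul_apply, smul_eq_mul]
  field_simp
  linarith
end

section
/- Let Q : ℝ^n → ℝ^n be a homogeneous polynomial map of degree m with DQ(x) symmetric for all x, and let c ∈ ℝ^n with ⟨c, c⟩ = 1 and Q(c) = α c for some α ∈ ℝ. Then: (1) DQ(c)c = mα·c (so c is an eigenvector of DQ(c) with eigenvalue mα); and (2) for Q*(x) := Q(x) − (⟨Q(x), x⟩/⟨x, x⟩)·x, every eigenvector v of DQ(c) with eigenvalue β satisfies DQ*(c)v − (β − α)v ∈ ℝ·c. -/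
theorem aux_diff {n : ℕ} (p : MvPolynomial (Fin n) ℝ) :
    Differentiable ℝ (fun x : Fin n → ℝ => MvPolynomial.eval x p) := by
  induction p using MvPolynomial.induction_on with
  | C a => simp
  | add p q hp hq =>
    simp only [map_add]
    exact hp.add hq
  | mul_X p i hp =>
    simp only [map_mul, MvPolynomial.eval_X]
    exact hp.mul (differentiable_apply i)

theorem aux_hom {n m : ℕ} (p : MvPolynomial (Fin n) ℝ) (hp : p.IsHomogeneous m)
    (t : ℝ) (x : Fin n → ℝ) :
    MvPolynomial.eval (t • x) p = t ^ m * MvPolynomial.eval x p := by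
  rw [MvPolynomial.eval_eq, MvPolynomial.eval_eq, Finset.mul_sum]
  refine Finset.sum_congr rfl fun d hd => ?_
  have h : d.degree = m := by
    by_contra h
    exact (MvPolynomial.mem_support_iff.1 hd) (hp.coeff_eq_zero h)
  simp only [Pi.smul_apply, smul_eq_mul, mul_pow, Finset.prod_mul_distrib,
    Finset.prod_pow_eq_pow_sum]
  rw [← h, Finsupp.degree_apply]
  ring

/-- Let `Q : ℝⁿ → ℝⁿ` be homogeneous of degree `m` with symmetric derivative, and let
`c` be a unit vector with `Q(c) = α·c`. Then `DQ(c)c = mα·c`, and for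
`Q*(x) = Q(x) − (⟨Q(x),x⟩/⟨x,x⟩)·x`, every eigenvector `v` of `DQ(c)` with eigenvalue `β`
satisfies `DQ*(c)v − (β − α)v ∈ ℝ·c`. -/
theorem stmt_9 {n m : ℕ}
    (Q : (Fin n → ℝ) → (Fin n → ℝ))
    (hQ : ∀ i : Fin n, ∃ p : MvPolynomial (Fin n) ℝ, p.IsHomogeneous m ∧
      ∀ x : Fin n → ℝ, Q x i = MvPolynomial.eval x p)
    (hsym : ∀ x y z : Fin n → ℝ,
      ∑ i, fderiv ℝ Q x y i * z i = ∑ i, fderiv ℝ Q x z i * y i)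
    (c : Fin n → ℝ) (hc : (∑ j, c j * c j) = 1) (α : ℝ) (hα : Q c = α • c) :
    fderiv ℝ Q c c = ((m : ℝ) * α) • c ∧
    ∀ (v : Fin n → ℝ) (β : ℝ), v ≠ 0 → fderiv ℝ Q c v = β • v →
      ∃ t : ℝ,
        fderiv ℝ (fun x => Q x - ((∑ j, Q x j * x j) / (∑ j, x j * x j)) • x) c v
          - (β - α) • v = t • c := by
  have hd : Differentiable ℝ Q := by
    rw [differentiable_pi]
    intro i
    obtain ⟨p, -, hp⟩ := hQ i
    simp only [hp]
    exact aux_diff p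
  have hh : ∀ t : ℝ, Q (t • c) = t ^ m • Q c := by
    intro t
    ext i
    obtain ⟨p, hm, hp⟩ := hQ i
    simp only [hp, Pi.smul_apply, smul_eq_mul]
    exact aux_hom p hm t c
  constructor
  · have h1 : HasDerivAt (fun t : ℝ => t • c) c 1 := by
      simpa using (hasDerivAt_id (1 : ℝ)).smul_const c
    have h2 : HasDerivAt (fun t : ℝ => Q (t • c)) (fderiv ℝ Q c c) 1 := by
      have h3 : HasFDerivAt Q (fderiv ℝ Q c) ((1 : ℝ) • c) := by
        rw [one_smul]
        exact (hd c).hasFDerivAt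
      exact h3.comp_hasDerivAt (1 : ℝ) h1
    have h4 : HasDerivAt (fun t : ℝ => Q (t • c)) ((m : ℝ) • Q c) 1 := by
      simp only [hh]
      simpa using (hasDerivAt_pow m (1 : ℝ)).smul_const (Q c)
    rw [h2.unique h4, hα, smul_smul]
  · intro v β _ hv
    have hdi : ∀ j, Differentiable ℝ (fun x => Q x j) := differentiable_pi.1 hd
    have hne : (∑ j, c j * c j) ≠ 0 := by rw [hc]; exact one_ne_zero
    have hg : DifferentiableAt ℝ
        (fun x : Fin n → ℝ => (∑ j, Q x j * x j) / (∑ j, x j * x j)) c := by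
      simp only [div_eq_mul_inv]
      refine DifferentiableAt.fun_mul ?_ (DifferentiableAt.fun_inv ?_ hne)
      · exact DifferentiableAt.fun_sum fun j _ => (hdi j c).mul (differentiable_apply j c)
      · exact DifferentiableAt.fun_sum fun j _ =>
          (differentiable_apply j c).mul (differentiable_apply j c)
    have hgc : (∑ j, Q c j * c j) / (∑ j, c j * c j) = α := by
      rw [hc, hα]
      simp only [Pi.smul_apply, smul_eq_mul, mul_assoc]
      rw [← Finset.mul_sum, hc]
      simp
    have h := (hd c).hasFDerivAt.sub (hg.hasFDerivAt.smul (hasFDerivAt_id c))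
    have h' := congrArg (fun L => L v) h.fderiv
    refine ⟨-(fderiv ℝ
        (fun x : Fin n → ℝ => (∑ j, Q x j * x j) / (∑ j, x j * x j)) c v), ?_⟩
    refine (congrArg (fun w => w - (β - α) • v) h').trans ?_
    simp only [hgc, id, ContinuousLinearMap.sub_apply, ContinuousLinearMap.add_apply,
      ContinuousLinearMap.smul_apply, ContinuousLinearMap.smulRight_apply, hv,
      ContinuousLinearMap.id_apply]
    module
end

section
/- Consider the ordinary differential equation ẋ = P(x) on ℝ^n, where P = P_0 + ⋯ + P_m is a polynomial map with P_k homogeneous of degree k, m > 1, and P_m ≠ 0. If there exist a nonzero c ∈ ℝ^n and α > 0 such that P_m(c) = α c, then the system has an unbounded solution: there exists a solution x : I → ℝ^n, defined on a nonempty interval I, with sup_{t ∈ I} ‖x(t)‖ = ∞. -/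
open Polynomial MeasureTheory Set Filter Topology


theorem lp_aux {E : Type*} [NormedAddCommGroup E] [NormedSpace ℝ E] [CompleteSpace E]
    (g : ℝ → E) (hg : Continuous g) (K B : ℝ) (hK : 0 < K) (hB : ∀ t, ‖g t‖ ≤ B) :
    (∀ t, HasDerivAt (fun t => -(Real.exp (K * t) • ∫ r in Ioi t, Real.exp (-K * r) • g r))
      (K • (-(Real.exp (K * t) • ∫ r in Ioi t, Real.exp (-K * r) • g r)) + g t) t) ∧
    ∀ t, ‖-(Real.exp (K * t) • ∫ r in Ioi t, Real.exp (-K * r) • g r)‖ ≤ B / K := by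
  have hc : Continuous (fun r => Real.exp (-K * r) • g r) := by fun_prop
  have hb : ∀ r, ‖Real.exp (-K * r) • g r‖ ≤ B * Real.exp (-K * r) := by
    intro r
    rw [norm_smul, Real.norm_eq_abs, abs_of_pos (Real.exp_pos _), mul_comm]
    exact mul_le_mul_of_nonneg_right (hB r) (Real.exp_pos _).le
  have hi : ∀ t, IntegrableOn (fun r => B * Real.exp (-K * r)) (Ioi t) := fun t =>
    (exp_neg_integrableOn_Ioi t hK).const_mul B
  have hint : ∀ t, IntegrableOn (fun r => Real.exp (-K * r) • g r) (Ioi t) := fun t =>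
    (hi t).mono' hc.aestronglyMeasurable (Eventually.of_forall hb)
  constructor
  · intro t
    have h1 : (fun t => ∫ r in Ioi t, Real.exp (-K * r) • g r) =
        fun t => (∫ r in Ioi 0, Real.exp (-K * r) • g r) - ∫ r in (0:ℝ)..t, Real.exp (-K * r) • g r := by
      funext t
      rw [eq_sub_iff_add_eq, add_comm]
      exact intervalIntegral.integral_interval_add_Ioi (hint _) (hint _)
    have h2 : HasDerivAt (fun t => ∫ r in Ioi t, Real.exp (-K * r) • g r)
        (-(Real.exp (-K * t) • g t)) t := by
      rw [h1]
      exact ((hc.integral_hasStrictDerivAt 0 t).hasDerivAt).const_sub _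
    have h3 : HasDerivAt (fun t => Real.exp (K * t)) (Real.exp (K * t) * K) t := by
      simpa using ((hasDerivAt_id t).const_mul K).exp
    refine (h3.smul h2).neg.congr_deriv ?_
    have : Real.exp (K * t) * Real.exp (-K * t) = 1 := by
      rw [← Real.exp_add]; simp
    simp only [smul_neg, smul_smul, this, one_smul, neg_add_rev, neg_neg]
    rw [mul_comm K (Real.exp _)]
  · intro t
    rw [norm_neg, norm_smul, Real.norm_eq_abs, abs_of_pos (Real.exp_pos _)]
    have h4 : ‖∫ r in Ioi t, Real.exp (-K * r) • g r‖ ≤ ∫ r in Ioi t, B * Real.exp (-K * r) :=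
      norm_integral_le_of_norm_le (hi t) (Eventually.of_forall hb)
    rw [integral_const_mul, integral_exp_mul_Ioi (by linarith)] at h4
    have : Real.exp (K * t) * Real.exp (-K * t) = 1 := by
      rw [← Real.exp_add]; simp
    calc _ ≤ Real.exp (K * t) * (B * (-Real.exp (-K * t) / -K)) := by gcongr
      _ = (Real.exp (K * t) * Real.exp (-K * t)) * B / K := by field_simp
      _ = _ := by rw [this, one_mul]

open scoped BoundedContinuousFunction

theorem lp_exists {E : Type*} [NormedAddCommGroup E] [NormedSpace ℝ E] [CompleteSpace E]
    (H : ℝ → E → E) (hH : Continuous (fun z : ℝ × E => H z.1 z.2)) (K L η : ℝ) (hL : 0 ≤ L)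
    (hLK : L < K) (hLip : ∀ t v w, ‖H t v - H t w‖ ≤ L * ‖v - w‖) (h0 : ∀ t, ‖H t 0‖ ≤ η) :
    ∃ v : ℝ → E, (∀ t, HasDerivAt v (K • v t + H t (v t)) t) ∧ ∀ t, ‖v t‖ ≤ η / (K - L) := by
  have hK : 0 < K := by linarith
  have hgc : ∀ v : ℝ →ᵇ E, Continuous (fun t => H t (v t)) := fun v =>
    hH.comp (continuous_id.prodMk v.continuous)
  have hgb : ∀ v : ℝ →ᵇ E, ∀ t, ‖H t (v t)‖ ≤ L * ‖v‖ + η := by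
    intro v t
    have h1 := hLip t (v t) 0
    have h2 := norm_add_le (H t (v t) - H t 0) (H t 0)
    rw [sub_add_cancel] at h2
    rw [sub_zero] at h1
    have h3 := mul_le_mul_of_nonneg_left (v.norm_coe_le_norm t) hL
    linarith [h0 t]
  let I : (ℝ → E) → ℝ → E := fun g t => -(Real.exp (K * t) • ∫ r in Ioi t, Real.exp (-K * r) • g r)
  have hI := fun v : ℝ →ᵇ E => lp_aux (fun t => H t (v t)) (hgc v) K _ hK (hgb v)
  let T : (ℝ →ᵇ E) → (ℝ →ᵇ E) := fun v =>
    BoundedContinuousFunction.ofNormedAddCommGroup (I (fun t => H t (v t)))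
      (continuous_iff_continuousAt.2 fun t => ((hI v).1 t).continuousAt) _ (hI v).2
  have hT : ∀ v t, T v t = I (fun t => H t (v t)) t := fun v t => rfl
  have hIint : ∀ v : ℝ →ᵇ E, ∀ t, IntegrableOn (fun r => Real.exp (-K * r) • H r (v r)) (Ioi t) := by
    intro v t
    refine ((exp_neg_integrableOn_Ioi t hK).const_mul (L * ‖v‖ + η)).mono' ?_ ?_
    · exact (Continuous.smul (by fun_prop) (hgc v)).aestronglyMeasurable
    · refine Eventually.of_forall fun r => ?_
      rw [norm_smul, Real.norm_eq_abs, abs_of_pos (Real.exp_pos _), mul_comm]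
      exact mul_le_mul_of_nonneg_right (hgb v r) (Real.exp_pos _).le
  have hcon : ContractingWith (Real.toNNReal (L / K)) T := by
    constructor
    · rw [Real.toNNReal_lt_one]
      exact (div_lt_one hK).2 hLK
    · refine LipschitzWith.of_dist_le_mul fun v w => ?_
      rw [Real.coe_toNNReal _ (by positivity)]
      rw [BoundedContinuousFunction.dist_le (by positivity)]
      intro t
      have hd : T v t - T w t = I (fun t => H t (v t) - H t (w t)) t := by
        simp only [hT, I]
        simp only [smul_sub]
        rw [integral_sub (hIint v t) (hIint w t), smul_sub]
        abel
      rw [dist_eq_norm, hd]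
      have := (lp_aux (fun t => H t (v t) - H t (w t)) ((hgc v).sub (hgc w)) K (L * dist v w) hK
        (fun t => (hLip t _ _).trans (by
          gcongr; rw [← dist_eq_norm]; exact BoundedContinuousFunction.dist_coe_le_dist t))).2 t
      calc _ ≤ _ := this
        _ = _ := by ring
  obtain ⟨v, hv⟩ : ∃ v, T v = v := ⟨_, hcon.fixedPoint_isFixedPt⟩
  have hvt : ∀ t, I (fun t => H t (v t)) t = v t := fun t => by rw [← hT, hv]
  refine ⟨v, fun t => ?_, fun t => ?_⟩
  · have h := (hI v).1 t
    have e : I (fun t => H t (v t)) = v := funext hvt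
    change HasDerivAt (I (fun t => H t (v t))) (K • I (fun t => H t (v t)) t + _) t at h
    rwa [e] at h
  · have hn : ‖v‖ ≤ (L * ‖v‖ + η) / K := by
      have hη : 0 ≤ η := (norm_nonneg _).trans (h0 0)
      rw [BoundedContinuousFunction.norm_le (by positivity)]
      intro t
      rw [← hvt]
      exact (hI v).2 t
    refine (v.norm_coe_le_norm t).trans ?_
    rw [le_div_iff₀ hK] at hn
    rw [le_div_iff₀ (by linarith)]
    linarith

theorem aeval_D_degree (g : ℝ[X]) (p : ℝ[X]) :
    (aeval (derivative (R := ℝ)) g p).natDegree ≤ p.natDegree := by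
  induction g using Polynomial.induction_on' with
  | add a b ha hb =>
    rw [map_add, LinearMap.add_apply]
    exact (natDegree_add_le _ _).trans (max_le ha hb)
  | monomial k a =>
    rw [aeval_monomial, Module.End.mul_apply, Module.algebraMap_end_apply, Module.End.pow_apply]
    refine (natDegree_smul_le _ _).trans ?_
    exact (natDegree_iterate_derivative p k).trans (Nat.sub_le _ _)

theorem deriv_surj (p : ℝ[X]) : ∃ u : ℝ[X], derivative u = p := by
  induction p using Polynomial.induction_on' with
  | add a b ha hb =>
    obtain ⟨u, hu⟩ := ha
    obtain ⟨v, hv⟩ := hb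
    exact ⟨u + v, by rw [derivative_add, hu, hv]⟩
  | monomial k a =>
    refine ⟨monomial (k + 1) (a / (k + 1)), ?_⟩
    rw [derivative_monomial]
    simp only [Nat.cast_add, Nat.cast_one, Nat.add_sub_cancel]
    congr 1
    have : (k : ℝ) + 1 ≠ 0 := by positivity
    field_simp

theorem unit_surj (a : ℝ) (ha : a ≠ 0) (g : ℝ[X]) : ∀ (d : ℕ) (p : ℝ[X]), p.natDegree < d →
    ∃ u : ℝ[X], aeval (derivative (R := ℝ)) (C a + X * g) u = p := by
  intro d
  induction d with
  | zero => intro p hp; omega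
  | succ d ih =>
    intro p hp
    set N := aeval (derivative (R := ℝ)) (X * g) with hN
    have hdeg : ∀ u, N u = derivative (aeval (derivative (R := ℝ)) g u) := by
      intro u; rw [hN, map_mul, aeval_X, Module.End.mul_apply]
    have hop : ∀ u, aeval (derivative (R := ℝ)) (C a + X * g) u = a • u + N u := by
      intro u
      rw [map_add, LinearMap.add_apply, aeval_C, Module.algebraMap_end_apply]
    have hsol : ∃ u2, aeval (derivative (R := ℝ)) (C a + X * g) u2 = N (a⁻¹ • p) := by
      by_cases h0 : (aeval (derivative (R := ℝ)) g (a⁻¹ • p)).natDegree = 0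
      · refine ⟨0, ?_⟩
        rw [map_zero, hdeg, derivative_of_natDegree_zero h0]
      · apply ih
        rw [hdeg]
        have h1 := natDegree_derivative_lt h0
        have h2 := aeval_D_degree g (a⁻¹ • p)
        have h3 := natDegree_smul_le a⁻¹ p
        omega
    obtain ⟨u2, hu2⟩ := hsol
    refine ⟨a⁻¹ • p - u2, ?_⟩
    rw [map_sub, hu2, hop, smul_smul, mul_inv_cancel₀ ha, one_smul, add_sub_cancel_right]

theorem poly_surj (f : ℝ[X]) (hf : f ≠ 0) (p : ℝ[X]) :
    ∃ u : ℝ[X], aeval (derivative (R := ℝ)) f u = p := by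
  obtain ⟨g, hg, hg2⟩ := Polynomial.exists_eq_pow_rootMultiplicity_mul_and_not_dvd f hf 0
  rw [map_zero, sub_zero] at hg hg2
  rw [X_dvd_iff] at hg2
  generalize rootMultiplicity 0 f = k at hg
  obtain ⟨v, hv⟩ : ∃ v : ℝ[X], (derivative (R := ℝ) ^ k) v = p := by
    clear hg
    induction k generalizing p with
    | zero => exact ⟨p, rfl⟩
    | succ k ih =>
      obtain ⟨w, hw⟩ := ih p
      obtain ⟨v, hv⟩ := deriv_surj w
      exact ⟨v, by rw [pow_succ, Module.End.mul_apply, hv, hw]⟩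
  obtain ⟨u, hu⟩ := unit_surj (g.coeff 0) hg2 g.divX _ v (Nat.lt_succ_self _)
  refine ⟨u, ?_⟩
  have : C (g.coeff 0) + X * g.divX = g := by rw [add_comm, X_mul_divX_add]
  rw [this] at hu
  rw [hg, map_mul, map_pow, aeval_X, Module.End.mul_apply, hu, hv]

theorem lin_surj {n : ℕ} (B : Matrix (Fin n) (Fin n) ℝ) (r : Fin n → ℝ[X]) :
    ∃ p : Fin n → ℝ[X], ∀ i, derivative (p i) - ∑ l, B i l • p l = r i := by
  choose u hu using fun i => poly_surj B.charpoly B.charpoly_monic.ne_zero (r i)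
  let φ : ℝ[X] →ₐ[ℝ] Module.End ℝ ℝ[X] := aeval (derivative (R := ℝ))
  obtain ⟨Q, hQ⟩ : ∃ Q : Fin n → Fin n → ℝ[X], ∀ i j,
      ∑ l, B.charmatrix i l * Q l j = if i = j then B.charpoly else 0 := by
    refine ⟨fun l j => B.charmatrix.adjugate l j, fun i j => ?_⟩
    have h := congrFun (congrFun (Matrix.mul_adjugate B.charmatrix) i) j
    rw [Matrix.mul_apply] at h
    rw [h, Matrix.smul_apply, Matrix.one_apply]
    split_ifs <;> simp [Matrix.charpoly]
  obtain ⟨v, hv⟩ : ∃ v : Fin n → ℝ[X], ∀ l, v l = ∑ j, φ (Q l j) (u j) := ⟨_, fun _ => rfl⟩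
  refine ⟨v, fun i => ?_⟩
  have h1 : ∀ p : Fin n → ℝ[X], derivative (p i) - ∑ l, B i l • p l
      = ∑ l, φ (B.charmatrix i l) (p l) := by
    intro p
    simp only [Matrix.charmatrix_apply, map_sub, LinearMap.sub_apply, Finset.sum_sub_distrib]
    congr 1
    · rw [Finset.sum_eq_single i]
      · simp [φ]
      · intro b _ hb
        simp [Matrix.diagonal_apply_ne' _ hb]
      · simp
    · simp [φ]
  rw [h1 v]
  simp only [hv, map_sum]
  rw [Finset.sum_comm]
  have h2 : ∀ j, ∑ l, φ (B.charmatrix i l) (φ (Q l j) (u j)) =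
      φ (if i = j then B.charpoly else 0) (u j) := by
    intro j
    rw [← hQ, map_sum, LinearMap.sum_apply]
    refine Finset.sum_congr rfl fun l _ => ?_
    rw [map_mul, Module.End.mul_apply]
  rw [Finset.sum_congr rfl fun j _ => h2 j, Finset.sum_eq_single i]
  · rw [if_pos rfl]
    exact hu i
  · intro b _ hb
    rw [if_neg hb.symm, map_zero, LinearMap.zero_apply]
  · simp

theorem taylor_aux {R : Type*} [CommRing R] [Algebra ℝ R] {n : ℕ} (q : R) (j : ℕ) (hj : 1 ≤ j)
    (Y δ : Fin n → R) (p : MvPolynomial (Fin n) ℝ) :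
    ∃ e, MvPolynomial.aeval (fun i => Y i + q ^ j * δ i) p = MvPolynomial.aeval Y p +
      q ^ j * (∑ l, MvPolynomial.aeval Y (MvPolynomial.pderiv l p) * δ l) + q ^ (j + 1) * e := by
  induction p using MvPolynomial.induction_on with
  | C a => exact ⟨0, by simp⟩
  | add f g hf hg =>
    obtain ⟨e, he⟩ := hf
    obtain ⟨e', he'⟩ := hg
    refine ⟨e + e', ?_⟩
    simp only [map_add, he, he', add_mul, Finset.sum_add_distrib]
    ring
  | mul_X f i hf =>
    obtain ⟨e, he⟩ := hf
    obtain ⟨k, rfl⟩ : ∃ k, j = k + 1 := ⟨j - 1, by omega⟩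
    set S := ∑ l, MvPolynomial.aeval Y (MvPolynomial.pderiv l f) * δ l with hS
    have h1 : ∑ l, MvPolynomial.aeval Y (MvPolynomial.pderiv l (f * MvPolynomial.X i)) * δ l
        = S * Y i + MvPolynomial.aeval Y f * δ i := by
      simp only [Derivation.leibniz, smul_eq_mul, map_add, map_mul, MvPolynomial.aeval_X, add_mul,
        Finset.sum_add_distrib]
      rw [add_comm]
      congr 1
      · rw [hS, Finset.sum_mul]
        exact Finset.sum_congr rfl fun l _ => by ring
      · rw [Finset.sum_eq_single i]
        · simp
        · intro b _ hb
          simp [MvPolynomial.pderiv_X_of_ne hb.symm]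
        · simp
    refine ⟨e * (Y i + q ^ (k + 1) * δ i) + q ^ k * S * δ i, ?_⟩
    rw [map_mul, map_mul, he, MvPolynomial.aeval_X, MvPolynomial.aeval_X, h1]
    ring

theorem ev_deriv (j : ℕ) (p : ℝ[X]) (t : ℝ) :
    HasDerivAt (fun t => evalEval t (Real.exp (-t)) (X ^ j * C p))
      (evalEval t (Real.exp (-t)) (X ^ j * C (derivative p - (j : ℝ) • p))) t := by
  have h1 : HasDerivAt (fun t => Real.exp (-t) ^ j) (-(j : ℝ) * Real.exp (-t) ^ j) t := by
    have e : ∀ t : ℝ, Real.exp (-t) ^ j = Real.exp (-(j : ℝ) * t) := fun t => by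
      rw [← Real.exp_nat_mul]; congr 1; ring
    simp only [e]
    refine (((hasDerivAt_id t).const_mul (-(j : ℝ))).exp).congr_deriv ?_
    simp [mul_comm]
  have h2 := h1.mul (p.hasDerivAt t)
  have e : ∀ (p : ℝ[X]) (t : ℝ), evalEval t (Real.exp (-t)) (X ^ j * C p) =
      Real.exp (-t) ^ j * eval t p := by
    intro p t
    rw [mul_comm, mul_comm (_ ^ _)]
    simp [evalEval]
  simp only [e]
  refine h2.congr_deriv ?_
  simp
  ring

theorem formal {n m : ℕ} (p : ℕ → Fin n → MvPolynomial (Fin n) ℝ) (c : Fin n → ℝ)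
    (hc : ∀ i, MvPolynomial.eval c (p m i) = c i) (K : ℕ) :
    ∃ Y Y' r : Fin n → ℝ[X][X], (∀ i, (Y i).coeff 0 = C (c i)) ∧
      (∀ i t, HasDerivAt (fun t => evalEval t (Real.exp (-t)) (Y i))
        (evalEval t (Real.exp (-t)) (Y' i)) t) ∧
      ∀ i, Y' i = ∑ k ∈ Finset.range (m + 1), X ^ (m - k) * MvPolynomial.aeval Y (p k i) - Y i
        + X ^ (K + 1) * r i := by
  have hc0 : ∀ (Y : Fin n → ℝ[X][X]), (∀ i, (Y i).coeff 0 = C (c i)) →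
      ∀ f : MvPolynomial (Fin n) ℝ, ∃ s, MvPolynomial.aeval Y f =
        C (C (MvPolynomial.eval c f)) + X * s := by
    intro Y hY f
    induction f using MvPolynomial.induction_on with
    | C a => exact ⟨0, by simp⟩
    | add f g hf hg =>
      obtain ⟨e, he⟩ := hf
      obtain ⟨e', he'⟩ := hg
      refine ⟨e + e', ?_⟩
      simp only [map_add, he, he']
      ring
    | mul_X f i hf =>
      obtain ⟨e, he⟩ := hf
      have h : Y i = C (C (c i)) + X * (Y i).divX := by
        rw [← hY i, add_comm, X_mul_divX_add]
      refine ⟨C (C (MvPolynomial.eval c f)) * (Y i).divX + e * Y i, ?_⟩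
      rw [map_mul, he, MvPolynomial.aeval_X, map_mul, MvPolynomial.eval_X, map_mul, map_mul]
      conv_lhs => rw [add_mul]; enter [1]; rw [h]
      ring
  induction K with
  | zero =>
    have hY : ∀ i, (C (C (c i)) : ℝ[X][X]).coeff 0 = C (c i) := fun i => coeff_C_zero
    choose s hs using fun k i => hc0 (fun i => C (C (c i))) hY (p k i)
    refine ⟨fun i => C (C (c i)), fun i => 0, fun i => -(s m i + ∑ k ∈ Finset.range m,
      X ^ (m - k - 1) * MvPolynomial.aeval (fun i => C (C (c i))) (p k i)), hY, ?_, ?_⟩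
    · intro i t
      simpa [evalEval] using hasDerivAt_const t (c i)
    · intro i
      rw [Finset.sum_range_succ, hs m i, hc]
      have h : ∑ k ∈ Finset.range m, X ^ (m - k) *
            MvPolynomial.aeval (fun i => (C (C (c i)) : ℝ[X][X])) (p k i) =
          X * ∑ k ∈ Finset.range m, X ^ (m - k - 1) *
            MvPolynomial.aeval (fun i => (C (C (c i)) : ℝ[X][X])) (p k i) := by
        rw [Finset.mul_sum]
        refine Finset.sum_congr rfl fun k hk => ?_
        rw [Finset.mem_range] at hk
        obtain ⟨d, hd⟩ : ∃ d, m - k = d + 1 := ⟨m - k - 1, by omega⟩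
        rw [hd, Nat.add_sub_cancel]
        ring
      rw [h, Nat.sub_self]
      ring
  | succ K ih =>
    obtain ⟨Y, Y', r, h0, h1, h2⟩ := ih
    let A : Matrix (Fin n) (Fin n) ℝ := fun i l => MvPolynomial.eval c (MvPolynomial.pderiv l (p m i))
    obtain ⟨w, hw⟩ := lin_surj (A + (K : ℝ) • 1) (fun i => -(r i).coeff 0)
    have hw' : ∀ i, derivative (w i) - ((K + 1 : ℕ) : ℝ) • w i =
        ∑ l, A i l • w l - w i - (r i).coeff 0 := by
      intro i
      have := hw i
      have e : ∑ l, (A + (K : ℝ) • (1 : Matrix (Fin n) (Fin n) ℝ)) i l • w l =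
          ∑ l, A i l • w l + (K : ℝ) • w i := by
        simp only [Matrix.add_apply, add_smul, Finset.sum_add_distrib, Matrix.smul_apply]
        congr 1
        rw [Finset.sum_eq_single i]
        · simp
        · intro b _ hb
          simp [Matrix.one_apply_ne' hb]
        · simp
      rw [e] at this
      push_cast
      rw [add_smul, one_smul]
      linear_combination this
    choose e he using fun k i => taylor_aux (X : ℝ[X][X]) (K + 1) (by omega) Y
      (fun i => C (w i)) (p k i)
    choose s hs using fun i l => hc0 Y h0 (MvPolynomial.pderiv l (p m i))
    have hr : ∀ i, r i = C ((r i).coeff 0) + X * (r i).divX := fun i => by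
      rw [add_comm, X_mul_divX_add]
    -- the lower-order terms
    have hlow : ∀ i, ∃ g, ∑ k ∈ Finset.range m, X ^ (m - k) *
        MvPolynomial.aeval (fun i => Y i + X ^ (K + 1) * C (w i)) (p k i) =
        ∑ k ∈ Finset.range m, X ^ (m - k) * MvPolynomial.aeval Y (p k i) + X ^ (K + 2) * g := by
      intro i
      refine ⟨∑ k ∈ Finset.range m, X ^ (m - k - 1) * ((∑ l, MvPolynomial.aeval Y
        (MvPolynomial.pderiv l (p k i)) * C (w l)) + X * e k i), ?_⟩
      rw [Finset.mul_sum, ← Finset.sum_add_distrib]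
      refine Finset.sum_congr rfl fun k hk => ?_
      rw [Finset.mem_range] at hk
      obtain ⟨d, hd⟩ : ∃ d, m - k = d + 1 := ⟨m - k - 1, by omega⟩
      rw [hd, Nat.add_sub_cancel, he]
      ring
    choose g hg using hlow
    have htop : ∀ i, MvPolynomial.aeval (fun i => Y i + X ^ (K + 1) * C (w i)) (p m i) =
        MvPolynomial.aeval Y (p m i) + X ^ (K + 1) * C (∑ l, A i l • w l) +
          X ^ (K + 2) * ((∑ l, s i l * C (w l)) + e m i) := by
      intro i
      rw [he]
      have : ∑ l, MvPolynomial.aeval Y (MvPolynomial.pderiv l (p m i)) * C (w l) =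
          C (∑ l, A i l • w l) + X * ∑ l, s i l * C (w l) := by
        rw [map_sum, Finset.mul_sum, ← Finset.sum_add_distrib]
        refine Finset.sum_congr rfl fun l _ => ?_
        rw [hs, smul_eq_C_mul, map_mul]
        ring
      rw [this]
      ring
    refine ⟨fun i => Y i + X ^ (K + 1) * C (w i),
      fun i => Y' i + X ^ (K + 1) * C (derivative (w i) - ((K + 1 : ℕ) : ℝ) • w i),
      fun i => (r i).divX - g i - ((∑ l, s i l * C (w l)) + e m i), ?_, ?_, ?_⟩
    · intro i
      simp [h0]
    · intro i t
      have := (h1 i t).add (ev_deriv (K + 1) (w i) t)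
      simp only [evalEval_add]
      exact this
    · intro i
      beta_reduce
      rw [hw', h2, Finset.sum_range_succ, Finset.sum_range_succ, hg, htop, Nat.sub_self]
      conv_lhs => enter [1, 2]; rw [hr i]
      rw [map_sub, map_sub]
      ring

theorem contDiff_mveval {n : ℕ} (p : MvPolynomial (Fin n) ℝ) :
    ContDiff ℝ 1 (fun y : Fin n → ℝ => MvPolynomial.eval y p) := by
  induction p using MvPolynomial.induction_on with
  | C a => simpa using contDiff_const
  | add f g hf hg => simpa using hf.add hg
  | mul_X f i hf => simpa using hf.mul (contDiff_apply ℝ ℝ i)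

theorem ev_decay (f : ℝ[X][X]) :
    Tendsto (fun t : ℝ => Real.exp (-t) * evalEval t (Real.exp (-t)) f) atTop (𝓝 0) := by
  have hexp : Tendsto (fun t : ℝ => Real.exp (-t)) atTop (𝓝 0) :=
    Real.tendsto_exp_neg_atTop_nhds_zero
  have hp : ∀ a : ℝ[X], Tendsto (fun t : ℝ => eval t a * Real.exp (-t)) atTop (𝓝 0) := by
    intro a
    induction a using Polynomial.induction_on' with
    | add a b ha hb => simpa [add_mul] using ha.add hb
    | monomial k a =>
      have := (Real.tendsto_pow_mul_exp_neg_atTop_nhds_zero k).const_mul a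
      simpa [mul_assoc] using this
  induction f using Polynomial.induction_on' with
  | add a b ha hb => simpa [mul_add] using ha.add hb
  | monomial k a =>
    have h := (hp a).mul (hexp.pow k)
    rw [zero_mul] at h
    refine h.congr fun t => ?_
    have : evalEval t (Real.exp (-t)) (monomial k a) = eval t a * Real.exp (-t) ^ k := by
      simp [evalEval]
    rw [this]
    ring

theorem ev_aeval {n : ℕ} (Y : Fin n → ℝ[X][X]) (t q : ℝ) (p : MvPolynomial (Fin n) ℝ) :
    evalEval t q (MvPolynomial.aeval Y p) = MvPolynomial.eval (fun i => evalEval t q (Y i)) p := by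
  induction p using MvPolynomial.induction_on with
  | C a => simp [evalEval]
  | add f g hf hg => simp [hf, hg]
  | mul_X f i hf => simp [hf, evalEval_mul]

/-- The rescaled vector field. -/
noncomputable def resc {n : ℕ} (m : ℕ) (p : ℕ → Fin n → MvPolynomial (Fin n) ℝ)
    (z : ℝ × (Fin n → ℝ)) : Fin n → ℝ := fun i =>
  ∑ k ∈ Finset.range (m + 1), z.1 ^ (m - k) * MvPolynomial.eval z.2 (p k i) - z.2 i

theorem resc_contDiff {n : ℕ} (m : ℕ) (p : ℕ → Fin n → MvPolynomial (Fin n) ℝ) :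
    ContDiff ℝ 1 (resc m p) := by
  rw [contDiff_pi]
  intro i
  unfold resc
  refine ContDiff.sub (ContDiff.sum fun k _ => ?_) ?_
  · exact (contDiff_fst.pow _).mul ((contDiff_mveval (p k i)).comp contDiff_snd)
  · exact (contDiff_apply ℝ ℝ i).comp contDiff_snd

theorem core_s10 {n m : ℕ} (p : ℕ → Fin n → MvPolynomial (Fin n) ℝ) (c : Fin n → ℝ)
    (hc : ∀ i, MvPolynomial.eval c (p m i) = c i) (ε : ℝ) (hε : 0 < ε) :
    ∃ (T : ℝ) (y : ℝ → Fin n → ℝ), ∀ t, T < t →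
      HasDerivAt y (resc m p (Real.exp (-t), y t)) t ∧ ‖y t - c‖ ≤ ε := by
  obtain ⟨L, hL⟩ := (resc_contDiff m p).contDiffOn.exists_lipschitzOnWith (one_ne_zero)
    ((convex_Icc (0:ℝ) 1).prod (convex_closedBall c 2))
    (isCompact_Icc.prod (isCompact_closedBall c 2))
  obtain ⟨K, hK⟩ := exists_nat_ge ((L : ℝ) + 1)
  have hK1 : (1 : ℝ) ≤ K := le_trans (by simp) hK
  obtain ⟨Y, Y', r, h0, h1, h2⟩ := formal p c hc K
  let Z : ℝ → Fin n → ℝ := fun t i => evalEval t (Real.exp (-t)) (Y i)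
  let Z' : ℝ → Fin n → ℝ := fun t i => evalEval t (Real.exp (-t)) (Y' i)
  let W : ℝ → Fin n → ℝ := fun t i => Real.exp (-t) * evalEval t (Real.exp (-t)) (r i)
  have hZ : ∀ t, HasDerivAt Z (Z' t) t := fun t => hasDerivAt_pi.2 fun i => h1 i t
  have hZc : Continuous Z := continuous_iff_continuousAt.2 fun t => (hZ t).continuousAt
  have hevc : ∀ f : ℝ[X][X], Continuous (fun t : ℝ => evalEval t (Real.exp (-t)) f) := by
    intro f
    induction f using Polynomial.induction_on' with
    | add a b ha hb =>
      simp only [evalEval_add]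
      exact ha.add hb
    | monomial k a =>
      have : ∀ t, evalEval t (Real.exp (-t)) (monomial k a) = eval t a * Real.exp (-t) ^ k := by
        intro t; simp [evalEval]
      simp only [this]
      fun_prop
  have hZ'c : Continuous Z' := continuous_pi fun i => hevc _
  have hWlim : Tendsto W atTop (𝓝 0) := tendsto_pi_nhds.2 fun i => ev_decay (r i)
  have hZlim : Tendsto Z atTop (𝓝 c) := by
    refine tendsto_pi_nhds.2 fun i => ?_
    have h := (ev_decay (Y i).divX).const_add (c i)
    rw [add_zero] at h
    refine h.congr fun t => ?_
    have e : Y i = C (C (c i)) + X * (Y i).divX := by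
      rw [← h0 i, add_comm, X_mul_divX_add]
    change _ = evalEval t (Real.exp (-t)) (Y i)
    conv_rhs => rw [e]
    rw [evalEval_add, evalEval_mul]
    simp [evalEval]
  have hElim : Tendsto (fun t : ℝ => Real.exp (-t)) atTop (𝓝 0) :=
    Real.tendsto_exp_neg_atTop_nhds_zero
  have hev : ∀ᶠ t in atTop, 0 ≤ t ∧ ‖W t‖ ≤ 1 ∧ ‖Z t - c‖ ≤ 1 ∧ ‖Z t - c‖ ≤ ε / 2 ∧
      Real.exp (-t) ≤ ε / 2 := by
    have a1 : ∀ᶠ t in atTop, ‖W t‖ ≤ 1 := by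
      have := hWlim.norm
      rw [norm_zero] at this
      exact this.eventually_le_const one_pos
    have a2 : Tendsto (fun t => ‖Z t - c‖) atTop (𝓝 0) := by
      have := (hZlim.sub_const c).norm
      simpa using this
    filter_upwards [eventually_ge_atTop 0, a1, a2.eventually_le_const one_pos,
      a2.eventually_le_const (half_pos hε), hElim.eventually_le_const (half_pos hε)]
      with t b1 b2 b3 b4 b5 using ⟨b1, b2, b3, b4, b5⟩
  obtain ⟨T, hT⟩ := eventually_atTop.1 hev
  have hres : ∀ t, resc m p (Real.exp (-t), Z t) - Z' t = -(Real.exp (-K * t) • W t) := by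
    intro t
    funext i
    have h := congrArg (evalEval t (Real.exp (-t))) (h2 i)
    have hpow : ∀ k, evalEval t (Real.exp (-t)) (X ^ k) = Real.exp (-t) ^ k := by
      intro k; simp [evalEval]
    rw [evalEval_add, evalEval_sub, evalEval_mul, ← coe_evalEvalRingHom, map_sum] at h
    simp only [coe_evalEvalRingHom, evalEval_mul, hpow, ev_aeval] at h
    have hx : Real.exp (-K * t) * Real.exp (-t) = Real.exp (-t) ^ (K + 1) := by
      rw [← Real.exp_nat_mul, ← Real.exp_add]; congr 1; push_cast; ring
    simp only [resc, Pi.sub_apply, Pi.neg_apply, Pi.smul_apply, smul_eq_mul, Z, Z', W]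
    rw [h, ← mul_assoc, hx]
    ring
  have hinv : ∀ t : ℝ, Real.exp (K * t) * Real.exp (-K * t) = 1 := by
    intro t; rw [← Real.exp_add]; simp
  have hEle : ∀ t : ℝ, 0 ≤ t → Real.exp (-K * t) ≤ Real.exp (-t) := by
    intro t ht
    apply Real.exp_le_exp.2
    nlinarith
  let cl : (Fin n → ℝ) → (Fin n → ℝ) := fun v i => max (-1) (min 1 (v i))
  have hclc : Continuous cl := by
    refine continuous_pi fun i => ?_
    fun_prop
  have hcl1 : ∀ v, ‖cl v‖ ≤ 1 := by
    intro v
    rw [pi_norm_le_iff_of_nonneg zero_le_one]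
    intro i
    rw [Real.norm_eq_abs, abs_le]
    exact ⟨le_max_left _ _, max_le (by norm_num) (min_le_left _ _)⟩
  have hclid : ∀ v, ‖v‖ ≤ 1 → cl v = v := by
    intro v hv
    funext i
    have := (norm_le_pi_norm v i).trans hv
    rw [Real.norm_eq_abs, abs_le] at this
    simp only [cl]
    rw [min_eq_right this.2, max_eq_right this.1]
  have hclL : ∀ v w, ‖cl v - cl w‖ ≤ ‖v - w‖ := by
    intro v w
    rw [pi_norm_le_iff_of_nonneg (norm_nonneg _)]
    intro i
    have h3 := norm_le_pi_norm (v - w) i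
    simp only [Pi.sub_apply, Real.norm_eq_abs, cl] at h3 ⊢
    refine le_trans ?_ h3
    have h4 := abs_max_sub_max_le_max (-1) (min 1 (v i)) (-1) (min 1 (w i))
    have h5 := abs_min_sub_min_le_max 1 (v i) 1 (w i)
    simp only [sub_self, abs_zero, abs_nonneg, max_eq_right] at h4 h5
    exact h4.trans h5
  let H0 : ℝ → (Fin n → ℝ) → (Fin n → ℝ) := fun t v =>
    Real.exp (K * t) • (resc m p (Real.exp (-t), Z t + Real.exp (-K * t) • v) - Z' t)
  have hH0c : Continuous (fun z : ℝ × (Fin n → ℝ) => H0 z.1 z.2) := by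
    have := (resc_contDiff m p).continuous
    simp only [H0]
    fun_prop
  have hmem : ∀ t v, T ≤ t → ‖v‖ ≤ 1 → (Real.exp (-t), Z t + Real.exp (-K * t) • v) ∈
      Icc (0:ℝ) 1 ×ˢ Metric.closedBall c 2 := by
    intro t v ht hv
    obtain ⟨b1, b2, b3, b4, b5⟩ := hT t ht
    have e1 : Real.exp (-t) ≤ 1 := Real.exp_le_one_iff.2 (by linarith)
    refine ⟨⟨(Real.exp_pos _).le, e1⟩, ?_⟩
    rw [Metric.mem_closedBall, dist_eq_norm]
    have e2 : ‖Real.exp (-K * t) • v‖ ≤ 1 := by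
      rw [norm_smul, Real.norm_eq_abs, abs_of_pos (Real.exp_pos _)]
      exact mul_le_one₀ ((hEle t b1).trans e1) (norm_nonneg _) hv
    calc ‖Z t + Real.exp (-K * t) • v - c‖ = ‖(Z t - c) + Real.exp (-K * t) • v‖ := by
          congr 1; abel
      _ ≤ _ := norm_add_le _ _
      _ ≤ 2 := by linarith
  have hH0L : ∀ t v w, T ≤ t → ‖v‖ ≤ 1 → ‖w‖ ≤ 1 → ‖H0 t v - H0 t w‖ ≤ L * ‖v - w‖ := by
    intro t v w ht hv hw
    have h := hL.dist_le_mul _ (hmem t v ht hv) _ (hmem t w ht hw)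
    rw [dist_eq_norm, Prod.dist_eq, dist_self, max_eq_right dist_nonneg, dist_eq_norm,
      add_sub_add_left_eq_sub, ← smul_sub, norm_smul, Real.norm_eq_abs,
      abs_of_pos (Real.exp_pos _)] at h
    simp only [H0]
    rw [← smul_sub, sub_sub_sub_cancel_right, norm_smul, Real.norm_eq_abs,
      abs_of_pos (Real.exp_pos _)]
    calc _ ≤ Real.exp (K * t) * (L * (Real.exp (-K * t) * ‖v - w‖)) := by gcongr
      _ = (Real.exp (K * t) * Real.exp (-K * t)) * (L * ‖v - w‖) := by ring
      _ = _ := by rw [hinv, one_mul]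
  obtain ⟨v, hv, hvb⟩ := lp_exists (fun t v => H0 (max t T) (cl v))
    (hH0c.comp ((continuous_fst.max continuous_const).prodMk (hclc.comp continuous_snd)))
    K L 1 L.2 (by linarith)
    (fun t v w => (hH0L _ _ _ (le_max_right _ _) (hcl1 v) (hcl1 w)).trans
      (mul_le_mul_of_nonneg_left (hclL v w) L.2))
    (fun t => by
      rw [hclid 0 (by simp)]
      simp only [H0]
      rw [smul_zero, add_zero, hres, smul_neg, smul_smul, hinv, one_smul, norm_neg]
      exact (hT _ (le_max_right _ _)).2.1)
  have hvb1 : ∀ t, ‖v t‖ ≤ 1 := fun t => (hvb t).trans (by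
    rw [div_le_one (by linarith)]; linarith)
  refine ⟨T, fun t => Z t + Real.exp (-K * t) • v t, fun t ht => ⟨?_, ?_⟩⟩
  · have hvt := hv t
    rw [max_eq_left ht.le, hclid _ (hvb1 t)] at hvt
    have he : HasDerivAt (fun t : ℝ => Real.exp (-K * t)) (Real.exp (-K * t) * -K) t := by
      simpa using ((hasDerivAt_id t).const_mul (-(K:ℝ))).exp
    refine ((hZ t).add (he.smul hvt)).congr_deriv ?_
    simp only [H0]
    rw [smul_add, smul_smul, smul_smul, mul_comm (Real.exp (-K * t)) (Real.exp (K * t)), hinv,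
      one_smul]
    module
  · obtain ⟨b1, b2, b3, b4, b5⟩ := hT t ht.le
    have e2 : ‖Real.exp (-K * t) • v t‖ ≤ ε / 2 := by
      rw [norm_smul, Real.norm_eq_abs, abs_of_pos (Real.exp_pos _)]
      calc _ ≤ Real.exp (-K * t) * 1 := by gcongr; exact hvb1 t
        _ ≤ _ := by rw [mul_one]; exact (hEle t b1).trans b5
    calc ‖Z t + Real.exp (-K * t) • v t - c‖ = ‖(Z t - c) + Real.exp (-K * t) • v t‖ := by
          congr 1; abel
      _ ≤ _ := norm_add_le _ _
      _ ≤ ε := by linarith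

theorem homog_eval {n k : ℕ} (p : MvPolynomial (Fin n) ℝ) (hp : p.IsHomogeneous k) (a : ℝ)
    (x : Fin n → ℝ) : MvPolynomial.eval (a • x) p = a ^ k * MvPolynomial.eval x p := by
  rw [MvPolynomial.eval_eq, MvPolynomial.eval_eq, Finset.mul_sum]
  refine Finset.sum_congr rfl fun d hd => ?_
  have h := hp (MvPolynomial.mem_support_iff.1 hd)
  have h2 : ∑ i ∈ d.support, d i = k := by
    rw [← h, Finsupp.weight_apply, Finsupp.sum]; simp
  simp only [Pi.smul_apply, smul_eq_mul, mul_pow, Finset.prod_mul_distrib]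
  rw [Finset.prod_pow_eq_pow_sum, h2]
  ring

/-- Consider `ẋ = P(x)` on `ℝⁿ` with `P = P₀ + ⋯ + P_m` a polynomial map, `m > 1`,
`P_m ≠ 0`. If `P_m(c) = α·c` for some `c ≠ 0` and `α > 0`, then the system has an
unbounded solution. -/
theorem stmt_10 {n m : ℕ} (hm : 1 < m) (P : ℕ → (Fin n → ℝ) → (Fin n → ℝ))
    (hP : ∀ k ≤ m, ∀ i : Fin n, ∃ p : MvPolynomial (Fin n) ℝ, p.IsHomogeneous k ∧
      ∀ x : Fin n → ℝ, P k x i = MvPolynomial.eval x p)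
    (hPm : P m ≠ 0)
    (c : Fin n → ℝ) (hc : c ≠ 0) (α : ℝ) (hα : 0 < α) (heig : P m c = α • c) :
    ∃ (a b : ℝ) (x : ℝ → (Fin n → ℝ)), a < b ∧
      (∀ t ∈ Set.Ioo a b, HasDerivAt x (∑ k ∈ Finset.range (m + 1), P k (x t)) t) ∧
      ∀ M : ℝ, ∃ t ∈ Set.Ioo a b, M < ‖x t‖ := by
  have hP' : ∀ k i, ∃ p : MvPolynomial (Fin n) ℝ, k ≤ m → p.IsHomogeneous k ∧
      ∀ x : Fin n → ℝ, P k x i = MvPolynomial.eval x p := by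
    intro k i
    by_cases hk : k ≤ m
    · obtain ⟨p, hp⟩ := hP k hk i
      exact ⟨p, fun _ => hp⟩
    · exact ⟨0, fun h => absurd h hk⟩
  choose p hp using hP'
  obtain ⟨d, rfl⟩ : ∃ d, m = d + 1 := ⟨m - 1, by omega⟩
  have hd : 0 < d := by omega
  have hdR : (0 : ℝ) < d := by exact_mod_cast hd
  obtain ⟨s, hs, hsα⟩ : ∃ s : ℝ, 0 < s ∧ s ^ d * α = 1 := by
    refine ⟨(α⁻¹) ^ ((d : ℝ)⁻¹), by positivity, ?_⟩
    rw [Real.rpow_inv_natCast_pow (by positivity) hd.ne', inv_mul_cancel₀ hα.ne']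
  have hc' : ∀ i, MvPolynomial.eval (s • c) (p (d + 1) i) = (s • c) i := by
    intro i
    obtain ⟨h1, h2⟩ := hp (d + 1) i le_rfl
    rw [homog_eval _ h1, ← h2, heig]
    simp only [Pi.smul_apply, smul_eq_mul]
    linear_combination (s * c i) * hsα
  have hcn : 0 < ‖s • c‖ := norm_pos_iff.2 (smul_ne_zero hs.ne' hc)
  obtain ⟨T, y, hy⟩ := core_s10 p (s • c) hc' (‖s • c‖ / 2) (half_pos hcn)
  set N := ‖s • c‖ with hN
  let τ : ℝ → ℝ := fun t => -(Real.log (-(d * t)) / d)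
  have hτpos : ∀ t ∈ Ioo (-(Real.exp (-(d * T)) / d)) 0, 0 < -(d * t) := by
    rintro t ⟨_, h⟩
    nlinarith
  have hτT : ∀ t ∈ Ioo (-(Real.exp (-(d * T)) / d)) 0, T < τ t := by
    rintro t ht
    have h1 : -(d * t) < Real.exp (-(d * T)) := by
      have := ht.1
      rw [neg_lt, lt_div_iff₀ hdR] at this
      linarith
    have h2 := Real.log_lt_log (hτpos t ht) h1
    rw [Real.log_exp] at h2
    simp only [τ]
    rw [lt_neg, div_lt_iff₀ hdR]
    linarith
  have hτe : ∀ t ∈ Ioo (-(Real.exp (-(d * T)) / d)) 0,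
      Real.exp (τ t) ^ d = (-(d * t))⁻¹ := by
    intro t ht
    rw [← Real.exp_nat_mul]
    have : d * τ t = - Real.log (-(d * t)) := by simp only [τ]; field_simp
    rw [this, Real.exp_neg, Real.exp_log (hτpos t ht)]
  have hτd : ∀ t ∈ Ioo (-(Real.exp (-(d * T)) / d)) 0, HasDerivAt τ (Real.exp (τ t) ^ d) t := by
    intro t ht
    have h1 : HasDerivAt (fun t : ℝ => -(d * t)) (-d : ℝ) t := by
      refine ((hasDerivAt_id t).const_mul (d : ℝ)).neg.congr_deriv ?_
      rw [mul_one]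
    have h2 := ((h1.log (hτpos t ht).ne').div_const (d : ℝ)).neg
    refine h2.congr_deriv ?_
    rw [hτe t ht]
    have := (hτpos t ht).ne'
    field_simp
  refine ⟨-(Real.exp (-(d * T)) / d), 0, fun t => Real.exp (τ t) • y (τ t), ?_, ?_, ?_⟩
  · have : 0 < Real.exp (-(d * T)) / d := by positivity
    linarith
  · intro t ht
    have h1 := (hy _ (hτT t ht)).1
    have h2 := (hτd t ht).exp.smul (h1.scomp t (hτd t ht))
    refine h2.congr_deriv ?_
    funext i
    simp only [Function.comp, Pi.add_apply, Pi.smul_apply, smul_eq_mul, Finset.sum_apply, resc]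
    have h3 : ∀ k ∈ Finset.range (d + 1 + 1), P k (Real.exp (τ t) • y (τ t)) i =
        Real.exp (τ t) ^ (d + 1) * (Real.exp (-τ t) ^ (d + 1 - k) *
          MvPolynomial.eval (y (τ t)) (p k i)) := by
      intro k hk
      have hk' : k ≤ d + 1 := by
        rw [Finset.mem_range] at hk; omega
      obtain ⟨g1, g2⟩ := hp k i hk'
      rw [g2, homog_eval _ g1, ← mul_assoc]
      congr 1
      obtain ⟨j, hj⟩ := Nat.exists_eq_add_of_le hk'
      rw [hj, Nat.add_sub_cancel_left, pow_add, mul_assoc, ← mul_pow, ← Real.exp_add]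
      simp
    rw [Finset.sum_congr rfl h3, ← Finset.mul_sum]
    ring
  · intro M
    obtain ⟨t1, ht1, ht2⟩ : ∃ t1, T < t1 ∧ M < Real.exp t1 * (N / 2) := by
      have h := (Real.tendsto_exp_atTop.atTop_mul_const (half_pos hcn)).eventually_gt_atTop M
      obtain ⟨t1, h1, h2⟩ := ((eventually_gt_atTop T).and h).exists
      exact ⟨t1, h1, h2⟩
    have hmem : -(Real.exp (-(d * t1)) / d) ∈ Ioo (-(Real.exp (-(d * T)) / d)) 0 := by
      constructor
      · have : Real.exp (-(d * t1)) < Real.exp (-(d * T)) := by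
          apply Real.exp_lt_exp.2; nlinarith
        have := div_lt_div_of_pos_right this hdR
        linarith
      · have : 0 < Real.exp (-(d * t1)) / d := by positivity
        linarith
    refine ⟨_, hmem, ?_⟩
    have hτ1 : τ (-(Real.exp (-(d * t1)) / d)) = t1 := by
      simp only [τ]
      have : -((d:ℝ) * -(Real.exp (-(d * t1)) / d)) = Real.exp (-(d * t1)) := by field_simp
      rw [this, Real.log_exp]
      field_simp
    simp only [hτ1]
    rw [norm_smul, Real.norm_eq_abs, abs_of_pos (Real.exp_pos _)]
    refine ht2.trans_le (mul_le_mul_of_nonneg_left ?_ (Real.exp_pos _).le)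
    have h1 := (hy t1 ht1).2
    have h2 := norm_sub_norm_le (s • c) (y t1)
    rw [norm_sub_rev] at h2
    linarith
end

section
/- Consider the ordinary differential equation ẋ = P(x) on ℝ^n, where P = P_0 + ⋯ + P_m is a polynomial map with P_k homogeneous of degree k, m > 1 even, and P_m ≠ 0. Then either the system has an unbounded solution, or every one-dimensional eigenspace of P_m is spanned by a nilpotent, i.e., every c ≠ 0 with P_m(c) ∈ ℝ·c satisfies P_m(c) = 0. -/
open BoundedContinuousFunction MeasureTheory Filter Topology

namespace Aux

section scalar
variable {V : Type*} [NormedAddCommGroup V] [NormedSpace ℂ V] [CompleteSpace V]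

lemma integrableOn_kernel {l : ℂ} (hl : l.re < 0) (f : ℝ →ᵇ V) (t : ℝ) :
    IntegrableOn (fun s : ℝ => Complex.exp (-l * s) • f s) (Set.Iic t) := by
  have h1 := (integrableOn_exp_mul_complex_Iic (a := -l) (by simpa using hl) t)
  refine Integrable.smul_bdd h1 ‖f‖ f.continuous.aestronglyMeasurable ?_
  exact Eventually.of_forall fun x => f.norm_coe_le_norm x

noncomputable def ker (l : ℂ) (f : ℝ →ᵇ V) (t : ℝ) : V :=
  Complex.exp (l * t) • ∫ s in Set.Iic t, Complex.exp (-l * s) • f s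

lemma ker_deriv {l : ℂ} (hl : l.re < 0) (f : ℝ →ᵇ V) (t : ℝ) :
    HasDerivAt (ker l f) (l • ker l f t + f t) t := by
  have hc : Continuous (fun s : ℝ => Complex.exp (-l * s) • f s) := by
    have := f.continuous
    fun_prop
  have h1 : HasDerivAt (fun t : ℝ => ∫ s in Set.Iic t, Complex.exp (-l * s) • f s)
      (Complex.exp (-l * t) • f t) t := by
    have h2 : (fun t : ℝ => ∫ s in Set.Iic t, Complex.exp (-l * s) • f s) =
        fun t => (∫ s in Set.Iic (0:ℝ), Complex.exp (-l * s) • f s) +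
          ∫ s in (0:ℝ)..t, Complex.exp (-l * s) • f s := by
      funext t
      rw [← intervalIntegral.integral_Iic_sub_Iic (integrableOn_kernel hl f 0)
        (integrableOn_kernel hl f t)]
      abel
    rw [h2]
    exact (intervalIntegral.integral_hasDerivAt_right (hc.intervalIntegrable _ _)
      (hc.stronglyMeasurableAtFilter _ _) hc.continuousAt).const_add _
  have h3 : HasDerivAt (fun t : ℝ => Complex.exp (l * t)) (Complex.exp (l * t) * l) t := by
    have : HasDerivAt (fun t : ℝ => l * (t : ℂ)) l t := by
      simpa using (Complex.ofRealCLM.hasDerivAt (x := t)).const_mul l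
    exact this.cexp
  have h4 := h3.smul h1
  refine h4.congr_deriv ?_
  have h5 : l * (t : ℂ) + -l * t = 0 := by ring
  rw [smul_smul, ← Complex.exp_add, ker, smul_smul, h5, Complex.exp_zero, one_smul, add_comm,
    mul_comm l (Complex.exp _)]

lemma ker_bound {l : ℂ} (hl : l.re < 0) (f : ℝ →ᵇ V) (t : ℝ) :
    ‖ker l f t‖ ≤ (-l.re)⁻¹ * ‖f‖ := by
  have h1 : ‖∫ s in Set.Iic t, Complex.exp (-l * s) • f s‖ ≤
      ∫ s in Set.Iic t, Real.exp (-l.re * s) * ‖f‖ := by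
    refine norm_integral_le_of_norm_le ?_ (Eventually.of_forall fun s => ?_)
    · exact (integrableOn_exp_mul_Iic (by simpa using hl) t).mul_const _
    · rw [norm_smul, Complex.norm_exp]
      simp only [Complex.mul_re, Complex.neg_re, Complex.ofReal_re, Complex.ofReal_im, mul_zero,
        sub_zero]
      gcongr
      exact f.norm_coe_le_norm s
  rw [integral_mul_const, integral_exp_mul_Iic (by simpa using hl)] at h1
  rw [ker, norm_smul, Complex.norm_exp]
  simp only [Complex.mul_re, Complex.ofReal_re, Complex.ofReal_im, mul_zero, sub_zero]
  calc _ ≤ Real.exp (l.re * t) * (Real.exp (-l.re * t) / -l.re * ‖f‖) := by gcongr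
    _ = (Real.exp (l.re * t) * Real.exp (-l.re * t)) * ((-l.re)⁻¹ * ‖f‖) := by ring
    _ = _ := by rw [← Real.exp_add]; simp

lemma scalar_neg {l : ℂ} (hl : l.re < 0) :
    ∃ G : (ℝ →ᵇ V) →L[ℂ] (ℝ →ᵇ V), ∀ f t, HasDerivAt (G f) (l • G f t + f t) t := by
  let G0 : (ℝ →ᵇ V) →ₗ[ℂ] (ℝ →ᵇ V) :=
    { toFun := fun f => ofNormedAddCommGroup (ker l f)
        (continuous_iff_continuousAt.2 fun t => (ker_deriv hl f t).continuousAt) _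
        (ker_bound hl f)
      map_add' := by
        intro f g
        ext t
        simp only [coe_ofNormedAddCommGroup, coe_add, Pi.add_apply, ker, smul_add]
        rw [integral_add (integrableOn_kernel hl f t) (integrableOn_kernel hl g t), smul_add]
      map_smul' := by
        intro a f
        ext t
        simp only [coe_ofNormedAddCommGroup, coe_smul, ker, RingHom.id_apply]
        simp_rw [smul_comm _ a]
        rw [integral_smul, smul_comm] }
  refine ⟨G0.mkContinuous (-l.re)⁻¹ fun f => ?_, fun f t => ker_deriv hl f t⟩
  refine norm_ofNormedAddCommGroup_le _ ?_ (ker_bound hl f)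
  have : 0 < -l.re := by linarith
  positivity

lemma scalar_ne {l : ℂ} (hl : l.re ≠ 0) :
    ∃ G : (ℝ →ᵇ V) →L[ℂ] (ℝ →ᵇ V), ∀ f t, HasDerivAt (G f) (l • G f t + f t) t := by
  rcases lt_or_gt_of_ne hl with h | h
  · exact scalar_neg h
  · obtain ⟨G, hG⟩ := scalar_neg (V := V) (l := -l) (by simpa using h)
    let R0 : (ℝ →ᵇ V) →ₗ[ℂ] (ℝ →ᵇ V) :=
      { toFun := fun f => f.compContinuous ⟨fun t => -t, continuous_neg⟩
        map_add' := fun f g => rfl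
        map_smul' := fun f g => rfl }
    let R : (ℝ →ᵇ V) →L[ℂ] (ℝ →ᵇ V) := R0.mkContinuous 1 fun f => by
      rw [one_mul]
      refine (norm_le (norm_nonneg _)).2 fun t => f.norm_coe_le_norm (-t)
    have hR : ∀ f t, R f t = f (-t) := fun f t => rfl
    refine ⟨-(R.comp (G.comp R)), fun f t => ?_⟩
    have h1 := hG (R f) (-t)
    have h2 := (h1.scomp t (hasDerivAt_neg t)).neg
    have h3 : (⇑((-(R.comp (G.comp R))) f)) = -((⇑(G (R f))) ∘ Neg.neg) := by
      funext s
      simp [hR]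
    rw [h3]
    refine h2.congr_deriv ?_
    simp [hR, add_comm]

lemma list_solve (B : V →L[ℂ] V) (L : List ℂ) (hL : ∀ l ∈ L, l.re ≠ 0) :
    Commute B (L.map (fun l => B - l • (1 : V →L[ℂ] V))).prod ∧
    ∃ G H : (ℝ →ᵇ V) →L[ℂ] (ℝ →ᵇ V), ∀ f t, HasDerivAt (G f)
      (B (G f t) + f t - (L.map (fun l => B - l • (1 : V →L[ℂ] V))).prod (H f t)) t := by
  induction L with
  | nil =>
    refine ⟨by simp, 0, ContinuousLinearMap.id _ _, fun f t => ?_⟩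
    simp
  | cons l L ih =>
    obtain ⟨hc, G, H, hG⟩ := ih fun x hx => hL x (by simp [hx])
    obtain ⟨S, hS⟩ := scalar_ne (V := V) (hL l (by simp))
    set N := (L.map (fun l => B - l • (1 : V →L[ℂ] V))).prod with hN
    have hcl : Commute B (B - l • (1 : V →L[ℂ] V)) :=
      (Commute.refl B).sub_right ((Commute.one_right B).smul_right l)
    have hcN : Commute (B - l • (1 : V →L[ℂ] V)) N :=
      hc.sub_left ((Commute.one_left N).smul_left l)
    simp only [List.map_cons, List.prod_cons, ← hN]
    refine ⟨hcl.mul_right hc, G + (N.compLeftContinuousBounded ℝ).comp (S.comp H), S.comp H,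
      fun f t => ?_⟩
    have h1 := hG f t
    have h2 := hS (H f) t
    have h3 := (N.restrictScalars ℝ).hasFDerivAt.comp_hasDerivAt t h2
    refine (h1.add h3).congr_deriv ?_
    rw [hcN.eq]
    have h4 : B (N (S (H f) t)) = N (B (S (H f) t)) := congrArg (fun T => T (S (H f) t)) hc.eq
    simp [h4]
    abel

end scalar

lemma real_solve {n : ℕ} (A : (Fin n → ℝ) →L[ℝ] (Fin n → ℝ)) :
    ∃ S : Finset ℝ, ∀ β ∉ S, ∃ G : (ℝ →ᵇ (Fin n → ℝ)) →L[ℝ] (ℝ →ᵇ (Fin n → ℝ)),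
      ∀ f t, HasDerivAt (G f) (A (G f t) + β • G f t + f t) t := by
  classical
  let M : Matrix (Fin n) (Fin n) ℂ := (LinearMap.toMatrix' (A : (Fin n → ℝ) →ₗ[ℝ] (Fin n → ℝ))).map
    Complex.ofReal
  let L : List ℂ := M.charpoly.roots.toList
  let Ac : (Fin n → ℂ) →L[ℂ] (Fin n → ℂ) := LinearMap.toContinuousLinearMap (Matrix.toLin' M)
  have hprod : (L.map (fun l => Ac - l • (1 : (Fin n → ℂ) →L[ℂ] (Fin n → ℂ)))).prod = 0 := by
    have h1 := M.aeval_self_charpoly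
    rw [(IsAlgClosed.splits M.charpoly).eq_prod_roots, M.charpoly_monic.leadingCoeff] at h1
    rw [← Multiset.coe_toList M.charpoly.roots] at h1
    simp only [map_one, one_mul, Multiset.map_coe, Multiset.prod_coe, map_list_prod, List.map_map] at h1
    let e : Matrix (Fin n) (Fin n) ℂ →+* ((Fin n → ℂ) →L[ℂ] (Fin n → ℂ)) :=
      (Module.End.toContinuousLinearMap (𝕜 := ℂ) (Fin n → ℂ)).toRingEquiv.toRingHom.comp
        (Matrix.toLinAlgEquiv' (R := ℂ) (n := Fin n)).toRingEquiv.toRingHom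
    have h2 := congrArg e h1
    rw [map_list_prod, map_zero, List.map_map] at h2
    rw [← h2]
    congr 1
    refine List.map_congr_left fun l _ => ?_
    simp only [Function.comp_apply, map_sub, Polynomial.aeval_X, Polynomial.aeval_C]
    congr 1
    rw [Algebra.algebraMap_eq_smul_one]
    ext x
    simp [e]
  refine ⟨(L.map fun l => -l.re).toFinset, fun β hβ => ?_⟩
  have hβ' : ∀ l ∈ L, l.re + β ≠ 0 := by
    intro l hl h0
    apply hβ
    simp only [List.mem_toFinset, List.mem_map]
    exact ⟨l, hl, by linarith⟩
  obtain ⟨-, G, H, hG⟩ := list_solve (Ac + (β : ℂ) • (1 : (Fin n → ℂ) →L[ℂ] (Fin n → ℂ)))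
    (L.map fun l => l + β) (by
      intro l hl
      obtain ⟨l', hl', rfl⟩ := List.mem_map.1 hl
      simpa using hβ' l' hl')
  have hz : ((L.map fun l => l + (β : ℂ)).map (fun l => Ac + (β : ℂ) • (1 : (Fin n → ℂ) →L[ℂ] (Fin n → ℂ))
      - l • (1 : (Fin n → ℂ) →L[ℂ] (Fin n → ℂ)))).prod = 0 := by
    rw [← hprod, List.map_map]
    congr 1
    refine List.map_congr_left fun l _ => ?_
    simp only [Function.comp_apply]
    rw [add_smul l (β : ℂ) (1 : (Fin n → ℂ) →L[ℂ] (Fin n → ℂ))]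
    abel
  rw [hz] at hG
  let ι : (Fin n → ℝ) →L[ℝ] (Fin n → ℂ) :=
    ContinuousLinearMap.pi fun i => Complex.ofRealCLM.comp (ContinuousLinearMap.proj i)
  let ρ : (Fin n → ℂ) →L[ℝ] (Fin n → ℝ) :=
    ContinuousLinearMap.pi fun i => Complex.reCLM.comp (ContinuousLinearMap.proj i)
  refine ⟨(ρ.compLeftContinuousBounded ℝ).comp ((G.restrictScalars ℝ).comp
    (ι.compLeftContinuousBounded ℝ)), fun f t => ?_⟩
  have h1 := ρ.hasFDerivAt.comp_hasDerivAt t (hG (ι.compLeftContinuousBounded ℝ f) t)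
  refine h1.congr_deriv ?_
  have hA : ∀ z, ρ (Ac z) = A (ρ z) := by
    intro z
    have h5 : A (ρ z) = Matrix.mulVec (LinearMap.toMatrix' (A : (Fin n → ℝ) →ₗ[ℝ] (Fin n → ℝ))) (ρ z) := by
      rw [← Matrix.toLin'_apply, Matrix.toLin'_toMatrix']; rfl
    rw [h5]
    ext i
    simp [ρ, Ac, M, Matrix.mulVec, dotProduct]
  have hι : ∀ z, ρ (ι z) = z := by
    intro z
    ext i
    simp [ρ, ι]
  simp [hA, hι]

lemma perturb {n : ℕ} (A : (Fin n → ℝ) →L[ℝ] (Fin n → ℝ)) (β : ℝ)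
    (G : (ℝ →ᵇ (Fin n → ℝ)) →L[ℝ] (ℝ →ᵇ (Fin n → ℝ)))
    (hG : ∀ f t, HasDerivAt (G f) (A (G f t) + β • G f t + f t) t)
    (F : ℝ → (Fin n → ℝ) → (Fin n → ℝ)) (hF : Continuous (Function.uncurry F))
    (hsmall : ∀ η > 0, ∀ᶠ s in atTop, ‖F s 0‖ ≤ η ∧ ∀ v w, ‖v‖ ≤ 1 → ‖w‖ ≤ 1 →
      ‖F s v - F s w‖ ≤ η * ‖v - w‖) :
    ∃ (s₀ : ℝ) (v : ℝ → (Fin n → ℝ)), ∀ s > s₀, ‖v s‖ ≤ 1 ∧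
      HasDerivAt v (A (v s) + β • v s + F s (v s)) s := by
  set K := ‖G‖ + 1 with hK
  have hKpos : 0 < K := by positivity
  have hGK : ∀ f, ‖G f‖ ≤ K * ‖f‖ := fun f => (G.le_opNorm f).trans (by gcongr; linarith)
  obtain ⟨s₀, hs₀⟩ := eventually_atTop.1 (hsmall (1 / (2 * K)) (by positivity))
  let π : (Fin n → ℝ) → (Fin n → ℝ) := fun v i => max (-1) (min 1 (v i))
  have hπc : Continuous π := by
    refine continuous_pi fun i => ?_
    fun_prop
  have hπ1 : ∀ v, ‖π v‖ ≤ 1 := by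
    intro v
    refine (pi_norm_le_iff_of_nonneg zero_le_one).2 fun i => ?_
    rw [Real.norm_eq_abs, abs_le]
    exact ⟨le_max_left _ _, max_le (by norm_num) (min_le_left _ _)⟩
  have hπ2 : ∀ v, ‖v‖ ≤ 1 → π v = v := by
    intro v hv
    ext i
    have := (norm_le_pi_norm v i).trans hv
    rw [Real.norm_eq_abs, abs_le] at this
    simp [π, this.1, this.2]
  have hπ3 : ∀ v w, ‖π v - π w‖ ≤ ‖v - w‖ := by
    intro v w
    refine (pi_norm_le_iff_of_nonneg (norm_nonneg _)).2 fun i => ?_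
    refine le_trans ?_ (norm_le_pi_norm (v - w) i)
    simp only [Pi.sub_apply, Real.norm_eq_abs, π]
    rw [max_comm (-1), max_comm (-1), min_comm 1, min_comm 1]
    refine (abs_max_sub_max_le_abs _ _ _).trans ?_
    refine (abs_min_sub_min_le_max _ _ _ _).trans ?_
    simp
  have hFb : ∀ s v, ‖F (max s s₀) (π v)‖ ≤ 1 / K := by
    intro s v
    obtain ⟨h0, h1⟩ := hs₀ (max s s₀) (le_max_right _ _)
    have h2 := h1 (π v) 0 (hπ1 v) (by simp)
    rw [sub_zero] at h2
    have h3 : 1 / (2 * K) * ‖π v‖ ≤ 1 / (2 * K) * 1 := by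
      gcongr
      exact hπ1 v
    have h4 : 1 / K = 1 / (2 * K) + 1 / (2 * K) := by field_simp; norm_num
    calc ‖F (max s s₀) (π v)‖ = ‖(F (max s s₀) (π v) - F (max s s₀) 0) + F (max s s₀) 0‖ := by simp
      _ ≤ _ := norm_add_le _ _
      _ ≤ 1 / K := by linarith
  let Φ : (ℝ →ᵇ (Fin n → ℝ)) → (ℝ →ᵇ (Fin n → ℝ)) := fun v =>
    ofNormedAddCommGroup (fun s => F (max s s₀) (π (v s)))
      (hF.comp ((continuous_id.max continuous_const).prodMk (hπc.comp v.continuous))) (1 / K)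
      (fun s => hFb s (v s))
  have hΦ : ∀ v s, Φ v s = F (max s s₀) (π (v s)) := fun v s => rfl
  have hLip : LipschitzWith (1 / 2) (fun v => G (Φ v)) := by
    refine LipschitzWith.of_dist_le_mul fun v w => ?_
    rw [dist_eq_norm, ← map_sub, dist_eq_norm]
    have h1 : ‖Φ v - Φ w‖ ≤ 1 / (2 * K) * ‖v - w‖ := by
      refine (norm_le (by positivity)).2 fun s => ?_
      rw [BoundedContinuousFunction.sub_apply, hΦ, hΦ]
      refine ((hs₀ (max s s₀) (le_max_right _ _)).2 _ _ (hπ1 _) (hπ1 _)).trans ?_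
      gcongr
      exact (hπ3 _ _).trans ((v - w).norm_coe_le_norm s)
    refine (hGK _).trans ?_
    calc K * ‖Φ v - Φ w‖ ≤ K * (1 / (2 * K) * ‖v - w‖) := by gcongr
      _ = _ := by push_cast; field_simp
  have hcon : ContractingWith (1 / 2) (fun v => G (Φ v)) := ⟨by
    rw [← NNReal.coe_lt_coe]; norm_num, hLip⟩
  set v := ContractingWith.fixedPoint _ hcon with hv
  have hfix : G (Φ v) = v := hcon.fixedPoint_isFixedPt
  have hv1 : ‖v‖ ≤ 1 := by
    rw [← hfix]
    refine (hGK _).trans ?_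
    have : ‖Φ v‖ ≤ 1 / K := (norm_le (by positivity)).2 fun s => hFb s (v s)
    calc K * ‖Φ v‖ ≤ K * (1 / K) := by gcongr
      _ = 1 := by field_simp
  refine ⟨s₀, v, fun s hs => ?_⟩
  have hvs := (v.norm_coe_le_norm s).trans hv1
  refine ⟨hvs, ?_⟩
  have := hG (Φ v) s
  rw [hfix, hΦ, hπ2 _ hvs, max_eq_left hs.le] at this
  exact this

end Aux

namespace Aux

/-- Small Lipschitz perturbation as `s → ∞`. -/
def Sm {n : ℕ} (F : ℝ → (Fin n → ℝ) → (Fin n → ℝ)) : Prop :=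
  ∀ η > 0, ∀ᶠ s in atTop, ‖F s 0‖ ≤ η ∧ ∀ v w, ‖v‖ ≤ 1 → ‖w‖ ≤ 1 →
      ‖F s v - F s w‖ ≤ η * ‖v - w‖

lemma Sm.add {n : ℕ} {F H : ℝ → (Fin n → ℝ) → (Fin n → ℝ)} (hF : Sm F) (hH : Sm H) :
    Sm (fun s v => F s v + H s v) := by
  intro η hη
  filter_upwards [hF (η / 2) (by positivity), hH (η / 2) (by positivity)] with s h1 h2
  refine ⟨(norm_add_le _ _).trans (by linarith [h1.1, h2.1]), fun v w hv hw => ?_⟩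
  have h3 := h1.2 v w hv hw
  have h4 := h2.2 v w hv hw
  rw [add_sub_add_comm]
  refine (norm_add_le _ _).trans ?_
  linarith

lemma Sm.sum {n : ℕ} (S : Finset ℕ) {F : ℕ → ℝ → (Fin n → ℝ) → (Fin n → ℝ)}
    (hF : ∀ k ∈ S, Sm (F k)) : Sm (fun s v => ∑ k ∈ S, F k s v) := by
  induction S using Finset.induction_on with
  | empty =>
    intro η hη
    refine Eventually.of_forall fun s => ⟨by simp [hη.le], fun v w _ _ => ?_⟩
    simp only [Finset.sum_empty, sub_self, norm_zero]
    positivity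
  | insert a S ha ih =>
    have h := (hF a (by simp)).add (ih fun k hk => hF k (by simp [hk]))
    simpa only [Finset.sum_insert ha] using h

lemma tendsto_exp_neg {a : ℝ} (ha : 0 < a) : Tendsto (fun s => Real.exp (-a * s)) atTop (𝓝 0) := by
  refine Real.tendsto_exp_atBot.comp ?_
  exact tendsto_id.const_mul_atTop_of_neg (by linarith)

lemma pair_close {n : ℕ} {c : Fin n → ℝ} {Q : (Fin n → ℝ) × (Fin n → ℝ) → Prop}
    (hQ : ∀ᶠ p in 𝓝 (c, c), Q p) {β : ℝ} (hβ : 0 < β) :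
    ∀ᶠ s in atTop, ∀ v w : Fin n → ℝ, ‖v‖ ≤ 1 → ‖w‖ ≤ 1 →
      Q (c + Real.exp (-β * s) • v, c + Real.exp (-β * s) • w) := by
  obtain ⟨δ, hδ, h⟩ := Metric.eventually_nhds_iff.1 hQ
  filter_upwards [(tendsto_exp_neg hβ).eventually (gt_mem_nhds hδ)] with s hs v w hv hw
  have key : ∀ u : Fin n → ℝ, ‖u‖ ≤ 1 → dist (c + Real.exp (-β * s) • u) c < δ := by
    intro u hu
    rw [dist_eq_norm, add_sub_cancel_left, norm_smul, Real.norm_eq_abs, Real.abs_exp]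
    calc _ ≤ Real.exp (-β * s) * 1 := by gcongr
      _ < δ := by simpa using hs
  apply h
  rw [Prod.dist_eq]
  exact max_lt (key v hv) (key w hw)

lemma sm_main {n : ℕ} {Q : (Fin n → ℝ) → (Fin n → ℝ)} {D : (Fin n → ℝ) →L[ℝ] (Fin n → ℝ)}
    {c : Fin n → ℝ} (hQ : HasStrictFDerivAt Q D c) {β : ℝ} (hβ : 0 < β) :
    Sm (fun s v => Real.exp (β * s) • (Q (c + Real.exp (-β * s) • v) - Q c
      - D (Real.exp (-β * s) • v))) := by
  intro η hη
  filter_upwards [pair_close (hQ.isLittleO.def hη) hβ] with s hs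
  refine ⟨by simp [hη.le], fun v w hv hw => ?_⟩
  have h := hs v w hv hw
  simp only [add_sub_add_left_eq_sub, ← smul_sub, norm_smul, Real.norm_eq_abs, Real.abs_exp] at h
  rw [← smul_sub, norm_smul, Real.norm_eq_abs, Real.abs_exp]
  have he : Real.exp (β * s) * Real.exp (-β * s) = 1 := by
    rw [← Real.exp_add]; simp
  have h2 : (Q (c + Real.exp (-β * s) • v) - Q c - D (Real.exp (-β * s) • v)) -
      (Q (c + Real.exp (-β * s) • w) - Q c - D (Real.exp (-β * s) • w)) =
      Q (c + Real.exp (-β * s) • v) - Q (c + Real.exp (-β * s) • w)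
        - D (Real.exp (-β * s) • (v - w)) := by
    rw [smul_sub, map_sub]; abel
  rw [h2]
  calc _ ≤ Real.exp (β * s) * (η * (Real.exp (-β * s) * ‖v - w‖)) := by gcongr
    _ = (Real.exp (β * s) * Real.exp (-β * s)) * (η * ‖v - w‖) := by ring
    _ = _ := by rw [he, one_mul]

lemma sm_low {n : ℕ} {Q : (Fin n → ℝ) → (Fin n → ℝ)} {D : (Fin n → ℝ) →L[ℝ] (Fin n → ℝ)}
    {c : Fin n → ℝ} (hQ : HasStrictFDerivAt Q D c) {β a : ℝ} (hβ : 0 < β) (ha : β < a) :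
    Sm (fun s v => Real.exp (β * s) • Real.exp (-a * s) • Q (c + Real.exp (-β * s) • v)) := by
  intro η hη
  obtain ⟨K, hK, hO⟩ := hQ.isBigO_sub.exists_pos
  have t1 : Tendsto (fun s => Real.exp (-(a - β) * s) * ‖Q c‖) atTop (𝓝 0) := by
    simpa using (tendsto_exp_neg (sub_pos.2 ha)).mul_const ‖Q c‖
  have t2 : Tendsto (fun s => Real.exp (-a * s) * K) atTop (𝓝 0) := by
    simpa using (tendsto_exp_neg (hβ.trans ha)).mul_const K
  filter_upwards [pair_close hO.bound hβ, t1.eventually (gt_mem_nhds hη),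
    t2.eventually (gt_mem_nhds hη)] with s hs h1 h2
  constructor
  · simp only [smul_zero, add_zero]
    rw [smul_smul, ← Real.exp_add, norm_smul, Real.norm_eq_abs, Real.abs_exp]
    have : β * s + -a * s = -(a - β) * s := by ring
    rw [this]
    exact h1.le
  · intro v w hv hw
    have h := hs v w hv hw
    simp only [add_sub_add_left_eq_sub, ← smul_sub, norm_smul, Real.norm_eq_abs, Real.abs_exp] at h
    rw [← smul_sub, ← smul_sub, norm_smul, norm_smul, Real.norm_eq_abs, Real.abs_exp,
      Real.norm_eq_abs, Real.abs_exp]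
    have he : Real.exp (β * s) * Real.exp (-β * s) = 1 := by
      rw [← Real.exp_add]; simp
    calc _ ≤ Real.exp (β * s) * (Real.exp (-a * s) * (K * (Real.exp (-β * s) * ‖v - w‖))) := by
          gcongr
      _ = (Real.exp (β * s) * Real.exp (-β * s)) * ((Real.exp (-a * s) * K) * ‖v - w‖) := by ring
      _ ≤ _ := by rw [he, one_mul]; gcongr

lemma blowup {n m : ℕ} (hm : 1 < m) (P : ℕ → (Fin n → ℝ) → (Fin n → ℝ))
    (hsm : ∀ k ≤ m, ContDiff ℝ 1 (P k))
    (hhom : ∀ k ≤ m, ∀ (a : ℝ) x, P k (a • x) = a ^ k • P k x)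
    {γ : ℝ} (hγ : γ * ((m : ℝ) - 1) = 1) (c : Fin n → ℝ) (hc0 : c ≠ 0) (hc : P m c = γ • c) :
    ∃ (a b : ℝ) (x : ℝ → (Fin n → ℝ)), a < b ∧
      (∀ t ∈ Set.Ioo a b, HasDerivAt x (∑ k ∈ Finset.range (m + 1), P k (x t)) t) ∧
      ∀ M : ℝ, ∃ t ∈ Set.Ioo a b, M < ‖x t‖ := by
  have hm' : (1 : ℝ) < m := by exact_mod_cast hm
  have hγ0 : 0 < γ := by
    by_contra h
    nlinarith
  have hst : ∀ k ≤ m, HasStrictFDerivAt (P k) (fderiv ℝ (P k) c) c := fun k hk =>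
    (hsm k hk).contDiffAt.hasStrictFDerivAt one_ne_zero
  set D := fderiv ℝ (P m) c with hD
  obtain ⟨S, hS⟩ := real_solve (D - γ • (1 : (Fin n → ℝ) →L[ℝ] (Fin n → ℝ)))
  obtain ⟨β, ⟨hβ0, hβγ⟩, hβS⟩ := (Set.Ioo_infinite hγ0).exists_notMem_finset S
  obtain ⟨G, hG⟩ := hS β hβS
  let F : ℝ → (Fin n → ℝ) → (Fin n → ℝ) := fun s v =>
    Real.exp (β * s) • (P m (c + Real.exp (-β * s) • v) - P m c - D (Real.exp (-β * s) • v)) +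
    ∑ k ∈ Finset.range m, Real.exp (β * s) • Real.exp (-(((m : ℝ) - k) * γ) * s) •
      P k (c + Real.exp (-β * s) • v)
  have hFc : Continuous (Function.uncurry F) := by
    have hcont : ∀ k ≤ m, Continuous fun p : ℝ × (Fin n → ℝ) =>
        P k (c + Real.exp (-β * p.1) • p.2) := fun k hk =>
      (hsm k hk).continuous.comp (by fun_prop)
    have hexp : ∀ r : ℝ, Continuous fun p : ℝ × (Fin n → ℝ) => Real.exp (r * p.1) := fun r => by
      fun_prop
    refine Continuous.add ?_ (continuous_finsetSum _ fun k hk => ?_)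
    · refine Continuous.smul (hexp β) (((hcont m le_rfl).sub continuous_const).sub ?_)
      exact D.continuous.comp (by fun_prop)
    · exact Continuous.smul (hexp β)
        (Continuous.smul (hexp _) (hcont k (Finset.mem_range.1 hk).le))
  have hFs : Sm F := by
    refine (sm_main (hst m le_rfl) hβ0).add (Sm.sum _ fun k hk => ?_)
    have hk := Finset.mem_range.1 hk
    refine sm_low (hst k hk.le) hβ0 ?_
    have : (k : ℝ) + 1 ≤ m := by exact_mod_cast hk
    nlinarith
  obtain ⟨s₀, v, hv⟩ := perturb _ β G hG F hFc hFs
  set z : ℝ → (Fin n → ℝ) := fun s => c + Real.exp (-β * s) • v s with hz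
  have hzd : ∀ s > s₀, HasDerivAt z (-(γ • z s) +
      ∑ k ∈ Finset.range (m + 1), Real.exp (-(((m : ℝ) - k) * γ) * s) • P k (z s)) s := by
    intro s hs
    have h1 := (hv s hs).2
    have h2 : HasDerivAt (fun s => Real.exp (-β * s)) (Real.exp (-β * s) * (-β)) s := by
      have : HasDerivAt (fun s : ℝ => -β * s) (-β) s := by
        simpa using (hasDerivAt_id s).const_mul (-β)
      exact this.exp
    refine ((h2.smul h1).const_add c).congr_deriv ?_
    have he : Real.exp (-β * s) * Real.exp (β * s) = 1 := by
      rw [← Real.exp_add]; simp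
    have h3 : Real.exp (-β * s) • F s (v s) = (P m (z s) - P m c - D (Real.exp (-β * s) • v s)) +
        ∑ k ∈ Finset.range m, Real.exp (-(((m : ℝ) - k) * γ) * s) • P k (z s) := by
      simp only [F, smul_add, Finset.smul_sum]
      congr 1
      · rw [smul_smul, he, one_smul]
      · refine Finset.sum_congr rfl fun k _ => ?_
        rw [smul_smul, he, one_smul]
    rw [smul_add, h3, Finset.sum_range_succ, hc]
    simp only [hz, sub_self, zero_mul, neg_zero, Real.exp_zero, one_smul, smul_add, map_smul,
      _root_.sub_apply, _root_.smul_apply, one_apply_eq_self]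
    module
  let y : ℝ → (Fin n → ℝ) := fun s => Real.exp (γ * s) • z s
  have hyd : ∀ s > s₀, HasDerivAt y (Real.exp (-s) • ∑ k ∈ Finset.range (m + 1), P k (y s)) s := by
    intro s hs
    have h2 : HasDerivAt (fun s => Real.exp (γ * s)) (Real.exp (γ * s) * γ) s := by
      have : HasDerivAt (fun s : ℝ => γ * s) γ s := by
        simpa using (hasDerivAt_id s).const_mul γ
      exact this.exp
    refine (h2.smul (hzd s hs)).congr_deriv ?_
    have h4 : ∀ k ∈ Finset.range (m + 1), Real.exp (-s) • P k (y s) =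
        Real.exp (γ * s) • Real.exp (-(((m : ℝ) - k) * γ) * s) • P k (z s) := by
      intro k hk
      have hk : k ≤ m := Nat.lt_succ_iff.1 (Finset.mem_range.1 hk)
      rw [hhom k hk, smul_smul, smul_smul, ← Real.exp_nat_mul, ← Real.exp_add, ← Real.exp_add]
      congr 2
      linear_combination s * hγ
    rw [Finset.smul_sum, Finset.sum_congr rfl h4, smul_add, Finset.smul_sum]
    module
  refine ⟨-Real.exp (-s₀), 0, fun t => y (-Real.log (-t)), by simp [Real.exp_pos], ?_, ?_⟩
  · rintro t ⟨ht1, ht2⟩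
    have hs : -Real.log (-t) > s₀ := by
      have : Real.log (-t) < -s₀ := (Real.log_lt_iff_lt_exp (by linarith)).2 (by linarith)
      linarith
    have hl : HasDerivAt (fun t : ℝ => -Real.log (-t)) (-t)⁻¹ t := by
      have := ((hasDerivAt_neg t).log (by linarith)).neg
      refine this.congr_deriv ?_
      field_simp
    refine ((hyd _ hs).scomp t hl).congr_deriv ?_
    rw [neg_neg, Real.exp_log (by linarith), smul_smul, inv_mul_cancel₀ (by linarith), one_smul]
  · intro M
    have hcn : 0 < ‖c‖ := norm_pos_iff.2 hc0
    have t1 : Tendsto (fun s => Real.exp (γ * s) * (‖c‖ / 2)) atTop atTop :=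
      (Real.tendsto_exp_atTop.comp (tendsto_id.const_mul_atTop hγ0)).atTop_mul_const (by positivity)
    obtain ⟨s, h1, h2, h3⟩ := ((t1.eventually_gt_atTop M).and
      (((tendsto_exp_neg hβ0).eventually (gt_mem_nhds (half_pos hcn))).and
        (eventually_gt_atTop s₀))).exists
    refine ⟨-Real.exp (-s), ⟨by simpa using h3, by simp [Real.exp_pos]⟩, ?_⟩
    have h4 : -Real.log (- -Real.exp (-s)) = s := by simp
    simp only [h4, y]
    rw [norm_smul, Real.norm_eq_abs, Real.abs_exp]
    refine h1.trans_le ?_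
    gcongr
    have h5 : ‖Real.exp (-β * s) • v s‖ ≤ ‖c‖ / 2 := by
      rw [norm_smul, Real.norm_eq_abs, Real.abs_exp]
      have := (hv s h3).1
      calc _ ≤ Real.exp (-β * s) * 1 := by gcongr
        _ ≤ _ := by simpa using h2.le
    have h6 : c = z s - Real.exp (-β * s) • v s := by simp [hz]
    have h7 : ‖c‖ ≤ ‖z s‖ + ‖Real.exp (-β * s) • v s‖ := by
      conv_lhs => rw [h6]
      exact norm_sub_le _ _
    linarith

end Aux

/-- Consider `ẋ = P(x)` on `ℝⁿ` with `P = P₀ + ⋯ + P_m` a polynomial map, `m > 1` even,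
`P_m ≠ 0`. Then either the system has an unbounded solution, or every one-dimensional
eigenspace of `P_m` is spanned by a nilpotent: every `c ≠ 0` with `P_m(c) ∈ ℝ·c`
satisfies `P_m(c) = 0`. -/
theorem stmt_11 {n m : ℕ} (hm : 1 < m) (hme : Even m)
    (P : ℕ → (Fin n → ℝ) → (Fin n → ℝ))
    (hP : ∀ k ≤ m, ∀ i : Fin n, ∃ p : MvPolynomial (Fin n) ℝ, p.IsHomogeneous k ∧
      ∀ x : Fin n → ℝ, P k x i = MvPolynomial.eval x p)
    (hPm : P m ≠ 0) :
    (∃ (a b : ℝ) (x : ℝ → (Fin n → ℝ)), a < b ∧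
      (∀ t ∈ Set.Ioo a b, HasDerivAt x (∑ k ∈ Finset.range (m + 1), P k (x t)) t) ∧
      ∀ M : ℝ, ∃ t ∈ Set.Ioo a b, M < ‖x t‖) ∨
    (∀ c : Fin n → ℝ, c ≠ 0 → (∃ l : ℝ, P m c = l • c) → P m c = 0) := by
  by_cases hall : ∀ c : Fin n → ℝ, c ≠ 0 → (∃ l : ℝ, P m c = l • c) → P m c = 0
  · exact Or.inr hall
  refine Or.inl ?_
  push Not at hall
  obtain ⟨c, hc0, ⟨l, hl⟩, hne⟩ := hall
  have hm' : (1 : ℝ) < m := by exact_mod_cast hm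
  have hsm : ∀ k ≤ m, ContDiff ℝ 1 (P k) := by
    intro k hk
    refine contDiff_pi.2 fun i => ?_
    obtain ⟨p, -, hp⟩ := hP k hk i
    have : (fun x => P k x i) = fun x => MvPolynomial.eval x p := funext hp
    rw [this]
    have key : ∀ q : MvPolynomial (Fin n) ℝ, ContDiff ℝ 1
        (fun x : Fin n → ℝ => MvPolynomial.eval x q) := by
      intro q
      induction q using MvPolynomial.induction_on with
      | C a => simpa using contDiff_const
      | add p q hp hq => simpa using hp.add hq
      | mul_X p i hp => simpa using hp.mul (contDiff_apply ℝ ℝ i)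
    exact key p
  have hhom : ∀ k ≤ m, ∀ (a : ℝ) x, P k (a • x) = a ^ k • P k x := by
    intro k hk a x
    ext i
    obtain ⟨p, hp1, hp⟩ := hP k hk i
    rw [Pi.smul_apply, hp, hp]
    simp only [MvPolynomial.eval_eq', Finset.smul_sum]
    refine Finset.sum_congr rfl fun d hd => ?_
    have hdeg : ∑ j, d j = k := by
      have h := hp1 (MvPolynomial.mem_support_iff.1 hd)
      rw [Finsupp.weight_apply, Finsupp.sum_fintype _ _ (by simp)] at h
      simpa using h
    simp only [Pi.smul_apply, smul_eq_mul, mul_pow, Finset.prod_mul_distrib,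
      Finset.prod_pow_eq_pow_sum, hdeg]
    ring
  have hl0 : l ≠ 0 := by
    rintro rfl
    exact hne (by simpa using hl)
  obtain ⟨c, hc0, l, hl0, hl⟩ : ∃ c : Fin n → ℝ, c ≠ 0 ∧ ∃ l : ℝ, 0 < l ∧ P m c = l • c := by
    rcases lt_or_gt_of_ne hl0 with h | h
    · refine ⟨-c, neg_ne_zero.2 hc0, -l, by linarith, ?_⟩
      have := hhom m le_rfl (-1) c
      rw [hme.neg_one_pow, one_smul, neg_one_smul] at this
      rw [this, hl]; simp
    · exact ⟨c, hc0, l, h, hl⟩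
  have hm1 : (0 : ℝ) < (m : ℝ) - 1 := by linarith
  set γ : ℝ := ((m : ℝ) - 1)⁻¹ with hγ
  have hγ0 : 0 < γ := by positivity
  set a : ℝ := (γ / l) ^ γ with ha
  have ha0 : 0 < a := by positivity
  have ha1 : a ^ (m - 1) = γ / l := by
    rw [ha, ← Real.rpow_mul_natCast (by positivity), Nat.cast_sub hm.le, Nat.cast_one, hγ,
      inv_mul_cancel₀ hm1.ne', Real.rpow_one]
  refine Aux.blowup hm P hsm hhom (inv_mul_cancel₀ hm1.ne') (a • c) (smul_ne_zero ha0.ne' hc0) ?_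
  rw [hhom m le_rfl, hl, smul_smul, smul_smul]
  congr 1
  have : a ^ m = a ^ (m - 1) * a := by rw [← pow_succ]; congr 1; omega
  rw [this, ha1]
  field_simp
  rw [hγ]
  exact inv_mul_cancel₀ hm1.ne'
end

section
/- For all real n×n matrices A and B, the determinant of the 2n×2n block matrix [[A, −B], [B, A]] is nonnegative. -/
/-- For all real `n×n` matrices `A` and `B`, the determinant of the `2n×2n` block matrix
`[[A, −B], [B, A]]` is nonnegative. -/
theorem stmt_17 {n : ℕ} (A B : Matrix (Fin n) (Fin n) ℝ) :
    0 ≤ (Matrix.fromBlocks A (-B) B A).det := by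
  let f : ℝ →+* ℂ := Complex.ofRealHom
  let a : Matrix (Fin n) (Fin n) ℂ := A.map f
  let b : Matrix (Fin n) (Fin n) ℂ := B.map f
  have hII : Complex.I • (Complex.I • b) = -b := by
    rw [smul_smul, Complex.I_mul_I, neg_one_smul]
  have key : Matrix.fromBlocks 1 (Complex.I • 1) 0 1 * Matrix.fromBlocks a (-b) b a
      * Matrix.fromBlocks 1 (-(Complex.I • 1)) 0 1
      = Matrix.fromBlocks (a + Complex.I • b) 0 b (a - Complex.I • b) := by
    rw [Matrix.fromBlocks_multiply, Matrix.fromBlocks_multiply]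
    congr 1
    · simp
    · simp only [Matrix.one_mul, Matrix.mul_one, Matrix.smul_mul, Matrix.mul_neg, Matrix.mul_smul,
        smul_add, hII]
      abel
    · simp
    · simp [sub_eq_add_neg, add_comm]
  have hdet := congrArg Matrix.det key
  rw [Matrix.det_mul, Matrix.det_mul, Matrix.det_fromBlocks_zero₂₁, Matrix.det_fromBlocks_zero₂₁,
    Matrix.det_fromBlocks_zero₁₂] at hdet
  simp only [Matrix.det_one, one_mul, mul_one] at hdet
  have hconj : (a - Complex.I • b).det = (starRingEnd ℂ) (a + Complex.I • b).det := by
    rw [RingHom.map_det]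
    congr 1
    ext i j
    simp [a, b, f, sub_eq_add_neg]
  have hmap : Matrix.fromBlocks a (-b) b a = f.mapMatrix (Matrix.fromBlocks A (-B) B A) := by
    rw [RingHom.mapMatrix_apply, Matrix.fromBlocks_map]
    congr 1
    ext i j
    simp [b]
  rw [hmap, ← RingHom.map_det, hconj, Complex.mul_conj] at hdet
  have h : (Matrix.fromBlocks A (-B) B A).det = Complex.normSq (a + Complex.I • b).det :=
    Complex.ofReal_injective hdet
  rw [h]
  exact Complex.normSq_nonneg _
end
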